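/- arXiv:1710.09115 — 2 statements merged into one kernel-verified Lean document; each statement's English description precedes it below -/
import Mathlib

section
/- Assume that V_n² = s_n² almost surely, and that there exist constants α > 0 and γ such that σ_k² ≥ α almost surely and E|X_k|³ ≤ γ for all 1 ≤ k ≤ n. Then d_W(L(S_n/s_n), N(0,1)) ≤ 3γ(1 + log n) / (α^{3/2} √n). -/
open MeasureTheory ProbabilityTheory Real Finset

lemma integrable_exp_neg_abs : Integrable (fun x : ℝ => rexp (-|x|)) := by
  have h : Integrable (fun x : ℝ => (1 + ‖x‖ ^ 2)⁻¹ * 2) := by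
    simpa using (integrable_inv_one_add_sq.mul_const 2)
  refine h.mono' (by fun_prop) (Filter.Eventually.of_forall fun x => ?_)
  rw [Real.norm_of_nonneg (exp_pos _).le, Real.exp_neg, Real.norm_eq_abs, ← div_eq_inv_mul,
    inv_eq_one_div, div_le_div_iff₀ (exp_pos _) (by positivity)]
  have := Real.quadratic_le_exp_of_nonneg (abs_nonneg x)
  nlinarith [abs_nonneg x]

/-- Differentiation under the integral sign for the convolution of a function of at most
exponential growth with a smooth kernel that decays faster. -/
lemma hasDerivAt_integral_add_mul {g q q' : ℝ → ℝ} {C D : ℝ} (hg : Continuous g)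
    (hgC : ∀ u, |g u| ≤ C * rexp |u|) (hq : ∀ v, HasDerivAt q (q' v) v) (hq' : Continuous q')
    (hqD : ∀ v, |q v| ≤ D * rexp (-2 * |v|)) (hqD' : ∀ v, |q' v| ≤ D * rexp (-2 * |v|)) (x : ℝ) :
    HasDerivAt (fun x => ∫ z, g (x + z) * q z) (-∫ z, g (x + z) * q' z) x := by
  have hqc : Continuous q := continuous_iff_continuousAt.2 fun v => (hq v).continuousAt
  have hC : 0 ≤ C := by
    have := (abs_nonneg _).trans (hgC 0)
    simpa using this
  have hD : 0 ≤ D := by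
    have := (abs_nonneg _).trans (hqD 0)
    simpa using this
  have key : ∀ p : ℝ → ℝ, ∀ y, ∫ z, g (y + z) * p z = ∫ u, g u * p (u - y) := by
    intro p y
    rw [← integral_add_left_eq_self (fun u => g u * p (u - y)) y]
    simp
  have dom : ∀ p : ℝ → ℝ, (∀ v, |p v| ≤ D * rexp (-2 * |v|)) → ∀ u, ∀ y ∈ Metric.ball x 1,
      ‖g u * p (u - y)‖ ≤ C * D * rexp (|x| + 2) * rexp (-|u - x|) := by
    intro p hp u y hy
    rw [Metric.mem_ball, Real.dist_eq] at hy
    rw [norm_mul, Real.norm_eq_abs, Real.norm_eq_abs]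
    calc |g u| * |p (u - y)| ≤ (C * rexp |u|) * (D * rexp (-2 * |u - y|)) := by
          gcongr
          · exact hgC u
          · exact hp _
      _ = C * D * rexp (|u| + (-2 * |u - y|)) := by rw [Real.exp_add]; ring
      _ ≤ C * D * rexp ((|x| + 2) + (-|u - x|)) := by
          refine mul_le_mul_of_nonneg_left (Real.exp_le_exp.2 ?_) (by positivity)
          have h1 : |u - x| ≤ |u - y| + |y - x| := abs_sub_le _ _ _
          have h2 : |u| ≤ |x| + |u - x| := by
            have := abs_add_le x (u - x)
            simpa using this
          linarith
      _ = _ := by rw [Real.exp_add (|x| + 2)]; ring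
  have hbi : Integrable (fun u => C * D * rexp (|x| + 2) * rexp (-|u - x|)) :=
    (integrable_exp_neg_abs.comp_sub_right x).const_mul _
  simp only [key]
  rw [← integral_neg]
  have := hasDerivAt_integral_of_dominated_loc_of_deriv_le (μ := volume)
    (F := fun y u => g u * q (u - y)) (F' := fun y u => -(g u * q' (u - y))) (x₀ := x)
    (bound := fun u => C * D * rexp (|x| + 2) * rexp (-|u - x|))
    (Metric.ball_mem_nhds x one_pos) (Filter.Eventually.of_forall fun y => by fun_prop)
    (hbi.mono' (by fun_prop) (Filter.Eventually.of_forall fun u =>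
      dom q hqD u x (Metric.mem_ball_self one_pos))) (by fun_prop)
    (Filter.Eventually.of_forall fun u y hy => by
      rw [norm_neg]; exact dom q' hqD' u y hy) hbi
    (Filter.Eventually.of_forall fun u y _ => by
      have h1 : HasDerivAt (fun y => u - y) (-1) y := by
        simpa using (hasDerivAt_id y).const_sub u
      have := ((hq (u - y)).comp y h1).const_mul (g u)
      simpa using this)
  exact this.2

/-- Second-order Taylor estimate for a function whose second derivative is Lipschitz. -/
lemma abs_taylor_two_le {H A B : ℝ → ℝ} {L : ℝ} (hH : ∀ x, HasDerivAt H (A x) x)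
    (hA : ∀ x, HasDerivAt A (B x) x) (hB : ∀ x y, |B x - B y| ≤ L * |x - y|) (x y : ℝ) :
    |H (x + y) - H x - y * A x - y ^ 2 / 2 * B x| ≤ L * |y| ^ 3 / 6 := by
  have pos : ∀ {H A B : ℝ → ℝ}, (∀ x, HasDerivAt H (A x) x) → (∀ x, HasDerivAt A (B x) x) →
      (∀ x y, |B x - B y| ≤ L * |x - y|) → ∀ x y, 0 ≤ y →
      |H (x + y) - H x - y * A x - y ^ 2 / 2 * B x| ≤ L * y ^ 3 / 6 := by
    intro H A B hH hA hB x y hy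
    have hA' : ∀ v, HasDerivAt (fun v => A (x + v) - A x - v * B x) (B (x + v) - B x) v := by
      intro v
      have h1 : HasDerivAt (fun v => A (x + v)) (B (x + v)) v := (hA (x + v)).comp_const_add x v
      simpa using (h1.sub_const (A x)).fun_sub ((hasDerivAt_id' v).mul_const (B x))
    have hH' : ∀ v, HasDerivAt (fun v => H (x + v) - H x - v * A x - v ^ 2 / 2 * B x)
        (A (x + v) - A x - v * B x) v := by
      intro v
      have h1 : HasDerivAt (fun v => H (x + v)) (A (x + v)) v := (hH (x + v)).comp_const_add x v
      have h2 : HasDerivAt (fun v : ℝ => v ^ 2 / 2) v v := by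
        have := (hasDerivAt_pow 2 v).div_const 2
        simpa using this
      simpa using ((h1.sub_const (H x)).fun_sub ((hasDerivAt_id' v).mul_const (A x))).fun_sub
        (h2.mul_const (B x))
    have b1 : ∀ v ∈ Set.Icc 0 y, ‖A (x + v) - A x - v * B x‖ ≤ L * v ^ 2 / 2 := by
      refine image_norm_le_of_norm_deriv_right_le_deriv_boundary
        (B := fun v => L * v ^ 2 / 2) (B' := fun v => L * v)
        (fun v _ => (hA' v).continuousAt.continuousWithinAt)
        (fun v _ => (hA' v).hasDerivWithinAt) (by simp) (fun v => ?_) (fun v hv => ?_)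
      · have := ((hasDerivAt_pow 2 v).const_mul L).div_const 2
        refine this.congr_deriv ?_
        norm_num
        ring
      · have := hB (x + v) x
        rw [Real.norm_eq_abs]
        simpa [abs_of_nonneg hv.1] using this
    have b2 : ∀ v ∈ Set.Icc 0 y, ‖H (x + v) - H x - v * A x - v ^ 2 / 2 * B x‖
        ≤ L * v ^ 3 / 6 := by
      refine image_norm_le_of_norm_deriv_right_le_deriv_boundary
        (B := fun v => L * v ^ 3 / 6) (B' := fun v => L * v ^ 2 / 2)
        (fun v _ => (hH' v).continuousAt.continuousWithinAt)
        (fun v _ => (hH' v).hasDerivWithinAt) (by simp) (fun v => ?_)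
        (fun v hv => b1 v ⟨hv.1, hv.2.le⟩)
      have := ((hasDerivAt_pow 3 v).const_mul L).div_const 6
      refine this.congr_deriv ?_
      norm_num
      ring
    exact b2 y ⟨hy, le_rfl⟩
  rcases le_total 0 y with hy | hy
  · rw [abs_of_nonneg hy]
    exact pos hH hA hB x y hy
  · have := pos (H := fun v => H (-v)) (A := fun v => -A (-v)) (B := fun v => B (-v))
      (fun v => by simpa [Function.comp_def] using (hH (-v)).comp v (hasDerivAt_neg' v))
      (fun v => by simpa [Function.comp_def] using ((hA (-v)).comp v (hasDerivAt_neg' v)).fun_neg)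
      (fun v w => by
        refine (hB _ _).trans (le_of_eq ?_)
        rw [← abs_neg]; ring_nf) (-x) (-y) (by linarith)
    rw [abs_of_nonpos hy]
    simpa [add_comm] using this

lemma hasDerivAt_stdGaussianPDF (v : ℝ) :
    HasDerivAt (gaussianPDFReal 0 1) (-(v * gaussianPDFReal 0 1 v)) v := by
  have h1 : HasDerivAt (fun v : ℝ => -(v - 0) ^ 2 / (2 * ((1 : NNReal) : ℝ))) (-v) v := by
    have := ((hasDerivAt_pow 2 v).fun_neg).div_const 2
    simp only [sub_zero, NNReal.coe_one, mul_one]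
    exact this.congr_deriv (by norm_num; ring)
  have := h1.exp.const_mul (√(2 * π * ((1 : NNReal) : ℝ)))⁻¹
  rw [gaussianPDFReal_def]
  refine this.congr_deriv ?_
  ring

lemma continuous_stdGaussianPDF : Continuous (gaussianPDFReal 0 1) :=
  continuous_iff_continuousAt.2 fun v => (hasDerivAt_stdGaussianPDF v).continuousAt

lemma stdGaussianPDF_le (v : ℝ) : gaussianPDFReal 0 1 v ≤ rexp (-v ^ 2 / 2) := by
  rw [gaussianPDFReal]
  have h1 : (√(2 * π * ((1 : NNReal) : ℝ)))⁻¹ ≤ 1 := by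
    refine inv_le_one_of_one_le₀ ?_
    rw [Real.one_le_sqrt]
    have := Real.pi_gt_three
    push_cast
    linarith
  simpa using mul_le_mul_of_nonneg_right h1 (exp_pos (-v ^ 2 / 2)).le

lemma abs_mul_stdGaussianPDF_le {p : ℝ → ℝ} (hp : ∀ v, |p v| ≤ 1 + v ^ 2) (v : ℝ) :
    |p v * gaussianPDFReal 0 1 v| ≤ 2 * rexp (9 / 2) * rexp (-2 * |v|) := by
  rw [abs_mul, abs_of_nonneg (gaussianPDFReal_nonneg 0 1 v)]
  have h1 : 1 + v ^ 2 ≤ 2 * rexp |v| := by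
    have := Real.quadratic_le_exp_of_nonneg (abs_nonneg v)
    rw [← sq_abs v]
    nlinarith [abs_nonneg v]
  calc |p v| * gaussianPDFReal 0 1 v ≤ (2 * rexp |v|) * rexp (-v ^ 2 / 2) :=
        mul_le_mul ((hp v).trans h1) (stdGaussianPDF_le v) (gaussianPDFReal_nonneg 0 1 v)
          (by positivity)
    _ = 2 * rexp (|v| + -v ^ 2 / 2) := by rw [Real.exp_add]; ring
    _ ≤ 2 * rexp (9 / 2 + -2 * |v|) := by
        refine mul_le_mul_of_nonneg_left (Real.exp_le_exp.2 ?_) (by positivity)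
        rw [← sq_abs v]
        nlinarith [sq_nonneg (|v| - 3)]
    _ = _ := by rw [Real.exp_add]; ring

lemma integral_stdGaussian (f : ℝ → ℝ) :
    ∫ z, f z ∂gaussianReal 0 1 = ∫ z, f z * gaussianPDFReal 0 1 z := by
  rw [integral_gaussianReal_eq_integral_smul one_ne_zero]
  simp [mul_comm]

lemma integrable_stdGaussian_iff (f : ℝ → ℝ) :
    Integrable f (gaussianReal 0 1) ↔ Integrable (fun z => f z * gaussianPDFReal 0 1 z) := by
  rw [gaussianReal_of_var_ne_zero 0 one_ne_zero,
    integrable_withDensity_iff (measurable_gaussianPDF 0 1)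
      (Filter.Eventually.of_forall fun x => gaussianPDF_lt_top)]
  simp [toReal_gaussianPDF]

lemma integrable_abs_pow_stdGaussian (n : ℕ) :
    Integrable (fun z : ℝ => |z| ^ n) (gaussianReal 0 1) := by
  rcases Nat.eq_zero_or_pos n with rfl | hn
  · simp
  · simpa using (memLp_id_gaussianReal (μ := 0) (v := 1) n).integrable_norm_pow hn.ne'

lemma integrable_pow_stdGaussian (n : ℕ) :
    Integrable (fun z : ℝ => z ^ n) (gaussianReal 0 1) :=
  (integrable_abs_pow_stdGaussian n).mono' (by fun_prop)
    (Filter.Eventually.of_forall fun z => by simp)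

lemma integral_sq_stdGaussian : ∫ z : ℝ, z ^ 2 ∂gaussianReal 0 1 = 1 := by
  have := variance_fun_id_gaussianReal (μ := 0) (v := 1)
  rw [variance_of_integral_eq_zero aemeasurable_id' integral_id_gaussianReal] at this
  simpa using this

lemma integral_pow_four_stdGaussian : ∫ z : ℝ, z ^ 4 ∂gaussianReal 0 1 = 3 := by
  have hd : ∀ z : ℝ, HasDerivAt (fun z => z ^ 3 * gaussianPDFReal 0 1 z)
      (3 * (z ^ 2 * gaussianPDFReal 0 1 z) - z ^ 4 * gaussianPDFReal 0 1 z) z := fun z => by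
    refine ((hasDerivAt_pow 3 z).fun_mul (hasDerivAt_stdGaussianPDF z)).congr_deriv ?_
    norm_num
    ring
  have hi := fun n => (integrable_stdGaussian_iff _).1 (integrable_pow_stdGaussian n)
  have := integral_eq_zero_of_hasDerivAt_of_integrable hd (((hi 2).const_mul 3).sub (hi 4)) (hi 3)
  rw [integral_sub ((hi 2).const_mul 3) (hi 4), integral_const_mul, ← integral_stdGaussian,
    ← integral_stdGaussian, integral_sq_stdGaussian] at this
  linarith

lemma integral_abs_pow_three_stdGaussian_le : ∫ z : ℝ, |z| ^ 3 ∂gaussianReal 0 1 ≤ 2 := by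
  have hi : Integrable (fun z : ℝ => (z ^ 2 + z ^ 4) / 2) (gaussianReal 0 1) :=
    ((integrable_pow_stdGaussian 2).add (integrable_pow_stdGaussian 4)).div_const 2
  have := integral_mono (integrable_abs_pow_stdGaussian 3) hi fun z => by
    have h2 : z ^ 2 = |z| ^ 2 := (sq_abs z).symm
    have h4 : z ^ 4 = |z| ^ 4 := (by decide : Even 4).pow_abs z |>.symm
    simp only [h2, h4]
    nlinarith [sq_nonneg (|z| ^ 2 - |z|)]
  rw [integral_div, integral_add (integrable_pow_stdGaussian 2) (integrable_pow_stdGaussian 4),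
    integral_sq_stdGaussian, integral_pow_four_stdGaussian] at this
  linarith

lemma integral_abs_sq_sub_one_stdGaussian_le :
    ∫ z : ℝ, |z ^ 2 - 1| ∂gaussianReal 0 1 ≤ 2 := by
  have hi := (integrable_pow_stdGaussian 2)
  have := integral_mono (hi.sub (integrable_const 1)).abs (hi.add (integrable_const 1)) fun z => by
    simp only [Pi.sub_apply, Pi.add_apply, abs_le]
    constructor <;> nlinarith [sq_nonneg z]
  rw [integral_add' hi (integrable_const 1), integral_sq_stdGaussian] at this
  simp at this
  linarith

lemma integral_abs_stdGaussian_le : ∫ z : ℝ, |z| ∂gaussianReal 0 1 ≤ 1 := by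
  have hi : Integrable (fun z : ℝ => (z ^ 2 + 1) / 2) (gaussianReal 0 1) :=
    ((integrable_pow_stdGaussian 2).add (integrable_const 1)).div_const 2
  have := integral_mono (by simpa using integrable_abs_pow_stdGaussian 1) hi fun z => by
    have h2 : z ^ 2 = |z| ^ 2 := (sq_abs z).symm
    simp only [h2]
    nlinarith [sq_nonneg (|z| - 1)]
  rw [integral_div, integral_add (integrable_pow_stdGaussian 2) (integrable_const 1),
    integral_sq_stdGaussian] at this
  simp at this
  linarith

lemma LipschitzWith.abs_sub_le {g : ℝ → ℝ} {K : NNReal} (hg : LipschitzWith K g) (x y : ℝ) :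
    |g x - g y| ≤ K * |x - y| := by
  simpa [Real.dist_eq] using hg.dist_le_mul x y

/-- A Lipschitz function times a function of quadratic growth is Gaussian integrable. -/
lemma LipschitzWith.integrable_mul_stdGaussian {g p : ℝ → ℝ} {K : NNReal}
    (hg : LipschitzWith K g) (hp : Continuous p) (hp2 : ∀ v, |p v| ≤ 1 + v ^ 2) (x c : ℝ) :
    Integrable (fun z => g (x + c * z) * p z) (gaussianReal 0 1) := by
  have hgc := hg.continuous
  have hb : Integrable (fun z : ℝ => |g x| + |g x| * z ^ 2 + K * |c| * |z| ^ 1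
      + K * |c| * |z| ^ 3) (gaussianReal 0 1) :=
    (((integrable_const _).add ((integrable_pow_stdGaussian 2).const_mul _)).add
      ((integrable_abs_pow_stdGaussian 1).const_mul _)).add
      ((integrable_abs_pow_stdGaussian 3).const_mul _)
  refine hb.mono' (by fun_prop) (Filter.Eventually.of_forall fun z => ?_)
  rw [norm_mul, Real.norm_eq_abs, Real.norm_eq_abs]
  have h1 : |g (x + c * z)| ≤ |g x| + K * (|c| * |z|) := by
    have h2 := hg.abs_sub_le (x + c * z) x
    rw [add_sub_cancel_left, abs_mul] at h2
    have h3 := abs_sub_abs_le_abs_sub (g (x + c * z)) (g x)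
    linarith
  calc |g (x + c * z)| * |p z| ≤ (|g x| + K * (|c| * |z|)) * (1 + z ^ 2) :=
        mul_le_mul h1 (hp2 z) (abs_nonneg _) (by positivity)
    _ = _ := by rw [← sq_abs z]; ring

lemma LipschitzWith.integrable_stdGaussian {g : ℝ → ℝ} {K : NNReal}
    (hg : LipschitzWith K g) (x c : ℝ) :
    Integrable (fun z => g (x + c * z)) (gaussianReal 0 1) := by
  simpa using hg.integrable_mul_stdGaussian (p := fun _ => 1) continuous_const
    (fun v => by simp; positivity) x c

/-- Third-order remainder estimate for the Gaussian smoothing of a Lipschitz function. -/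
lemma LipschitzWith.abs_stdGaussian_smoothing_taylor_le {g : ℝ → ℝ} {K : NNReal}
    (hg : LipschitzWith K g) (x y : ℝ) :
    |(∫ z, g (x + y + z) ∂gaussianReal 0 1) - (∫ z, g (x + z) ∂gaussianReal 0 1)
      - y * (∫ z, g (x + z) * z ∂gaussianReal 0 1)
      - y ^ 2 / 2 * (∫ z, g (x + z) * (z ^ 2 - 1) ∂gaussianReal 0 1)| ≤ K * |y| ^ 3 / 3 := by
  have hgc := hg.continuous
  have hgrow : ∀ u, |g u| ≤ (|g 0| + K) * rexp |u| := fun u => by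
    have h2 := hg.abs_sub_le u 0
    have h3 := abs_sub_abs_le_abs_sub (g u) (g 0)
    have h4 := Real.add_one_le_exp |u|
    have h5 := abs_nonneg u
    rw [sub_zero] at h2
    nlinarith [mul_nonneg (abs_nonneg (g 0)) (by linarith : 0 ≤ rexp |u| - 1),
      mul_nonneg K.2 (by linarith : 0 ≤ rexp |u| - |u|)]
  have p0 : ∀ v : ℝ, |(fun _ => 1 : ℝ → ℝ) v| ≤ 1 + v ^ 2 := fun v => by simp; positivity
  have p1 : ∀ v : ℝ, |v| ≤ 1 + v ^ 2 := fun v => by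
    rw [← sq_abs]; nlinarith [sq_nonneg (|v| - 1), abs_nonneg v]
  have p1' : ∀ v : ℝ, |-v| ≤ 1 + v ^ 2 := fun v => by rw [abs_neg]; exact p1 v
  have p2 : ∀ v : ℝ, |v ^ 2 - 1| ≤ 1 + v ^ 2 := fun v => by
    rw [abs_le]; constructor <;> nlinarith [sq_nonneg v]
  have p2' : ∀ v : ℝ, |1 - v ^ 2| ≤ 1 + v ^ 2 := fun v => by rw [abs_sub_comm]; exact p2 v
  have hφ := continuous_stdGaussianPDF
  have hH : ∀ x, HasDerivAt (fun x => ∫ z, g (x + z) ∂gaussianReal 0 1)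
      (∫ z, g (x + z) * z ∂gaussianReal 0 1) x := fun x => by
    have := hasDerivAt_integral_add_mul (q' := fun v => -v * gaussianPDFReal 0 1 v) hgc hgrow
      (fun v => (hasDerivAt_stdGaussianPDF v).congr_deriv (by ring))
      (by fun_prop) (fun v => by simpa using abs_mul_stdGaussianPDF_le p0 v)
      (abs_mul_stdGaussianPDF_le p1') x
    simp only [integral_stdGaussian]
    refine this.congr_deriv ?_
    rw [← integral_neg]
    congr 1; ext z; ring
  have hA : ∀ x, HasDerivAt (fun x => ∫ z, g (x + z) * z ∂gaussianReal 0 1)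
      (∫ z, g (x + z) * (z ^ 2 - 1) ∂gaussianReal 0 1) x := fun x => by
    have := hasDerivAt_integral_add_mul (q := fun v => v * gaussianPDFReal 0 1 v)
      (q' := fun v => (1 - v ^ 2) * gaussianPDFReal 0 1 v) hgc hgrow
      (fun v => ((hasDerivAt_id' v).fun_mul (hasDerivAt_stdGaussianPDF v)).congr_deriv (by ring))
      (by fun_prop) (abs_mul_stdGaussianPDF_le p1) (abs_mul_stdGaussianPDF_le p2') x
    simp only [integral_stdGaussian, mul_assoc]
    refine this.congr_deriv ?_
    rw [← integral_neg]
    congr 1; ext z; ring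
  have hB : ∀ x y, |(∫ z, g (x + z) * (z ^ 2 - 1) ∂gaussianReal 0 1)
      - ∫ z, g (y + z) * (z ^ 2 - 1) ∂gaussianReal 0 1| ≤ 2 * K * |x - y| := fun x y => by
    have hi := fun x => hg.integrable_mul_stdGaussian (by fun_prop) p2 x 1
    simp only [one_mul] at hi
    rw [← integral_sub (hi x) (hi y)]
    have hi2 : Integrable (fun z : ℝ => K * |x - y| * |z ^ 2 - 1|) (gaussianReal 0 1) :=
      ((integrable_pow_stdGaussian 2).sub (integrable_const 1)).abs.const_mul _
    calc _ ≤ ∫ z, K * |x - y| * |z ^ 2 - 1| ∂gaussianReal 0 1 := by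
          rw [← Real.norm_eq_abs]
          refine norm_integral_le_of_norm_le hi2 (Filter.Eventually.of_forall fun z => ?_)
          rw [← sub_mul, norm_mul, Real.norm_eq_abs, Real.norm_eq_abs]
          gcongr
          simpa using hg.abs_sub_le (x + z) (y + z)
      _ ≤ K * |x - y| * 2 := by
          rw [integral_const_mul]
          gcongr
          exact integral_abs_sq_sub_one_stdGaussian_le
      _ = _ := by ring
  refine (abs_taylor_two_le hH hA hB x y).trans (le_of_eq (by ring))

/-- The expectation of `h` under the normal distribution with mean `x` and variance `t`. -/
noncomputable def gaussSmooth (h : ℝ → ℝ) (x t : ℝ) : ℝ :=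
  ∫ z, h (x + √t * z) ∂gaussianReal 0 1

section GaussSmooth

variable {h : ℝ → ℝ}

@[simp]
lemma gaussSmooth_zero (x : ℝ) : gaussSmooth h x 0 = h x := by
  simp [gaussSmooth]

lemma measurable_integral_gaussSmooth (hh : LipschitzWith 1 h) {p : ℝ → ℝ} (hp : Continuous p) :
    Measurable fun q : ℝ × ℝ => ∫ z, h (q.1 + √q.2 * z) * p z ∂gaussianReal 0 1 := by
  have hc := hh.continuous
  have : Continuous fun r : (ℝ × ℝ) × ℝ => h (r.1.1 + √r.1.2 * r.2) * p r.2 := by fun_prop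
  exact this.stronglyMeasurable.integral_prod_right'.measurable

lemma measurable_gaussSmooth (hh : LipschitzWith 1 h) :
    Measurable fun q : ℝ × ℝ => gaussSmooth h q.1 q.2 := by
  simpa [gaussSmooth] using measurable_integral_gaussSmooth hh (p := fun _ => 1) continuous_const

lemma integrable_gaussSmooth (hh : LipschitzWith 1 h) (x t : ℝ) :
    Integrable (fun z => h (x + √t * z)) (gaussianReal 0 1) :=
  hh.integrable_stdGaussian x √t

lemma abs_gaussSmooth_sub_le (hh : LipschitzWith 1 h) (x y t : ℝ) :
    |gaussSmooth h x t - gaussSmooth h y t| ≤ |x - y| := by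
  rw [gaussSmooth, gaussSmooth,
    ← integral_sub (integrable_gaussSmooth hh x t) (integrable_gaussSmooth hh y t),
    ← Real.norm_eq_abs]
  refine (norm_integral_le_of_norm_le_const (C := |x - y|)
    (Filter.Eventually.of_forall fun z => ?_)).trans (by simp)
  simpa using hh.abs_sub_le (x + √t * z) (y + √t * z)

lemma lipschitzWith_gaussSmooth (hh : LipschitzWith 1 h) (t : ℝ) :
    LipschitzWith 1 fun x => gaussSmooth h x t :=
  LipschitzWith.of_dist_le_mul fun x y => by
    simpa [Real.dist_eq] using abs_gaussSmooth_sub_le hh x y t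

lemma abs_gaussSmooth_sub_self_le (hh : LipschitzWith 1 h) (x t : ℝ) :
    |gaussSmooth h x t - h x| ≤ √t := by
  have h0 : h x = ∫ _, h x ∂gaussianReal 0 1 := by simp
  rw [gaussSmooth, h0, ← integral_sub (integrable_gaussSmooth hh x t) (integrable_const _),
    ← Real.norm_eq_abs]
  have hi : Integrable (fun z : ℝ => √t * |z|) (gaussianReal 0 1) := by
    simpa using (integrable_abs_pow_stdGaussian 1).const_mul √t
  refine (norm_integral_le_of_norm_le hi (Filter.Eventually.of_forall fun z => ?_)).trans ?_
  · simpa [abs_mul, abs_of_nonneg (Real.sqrt_nonneg t)] using hh.abs_sub_le (x + √t * z) x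
  · rw [integral_const_mul]
    exact mul_le_of_le_one_right (Real.sqrt_nonneg t) integral_abs_stdGaussian_le

lemma map_sqrt_mul_stdGaussian {t : ℝ} (ht : 0 ≤ t) :
    (gaussianReal 0 1).map (√t * ·) = gaussianReal 0 t.toNNReal := by
  rw [gaussianReal_map_const_mul]
  congr 1
  · simp
  · ext
    simp [Real.sq_sqrt ht, ht]

/-- Semigroup property of Gaussian smoothing. -/
lemma gaussSmooth_add (hh : LipschitzWith 1 h) (x : ℝ) {t s : ℝ} (ht : 0 ≤ t) (hs : 0 ≤ s) :
    gaussSmooth h x (t + s) = ∫ z, gaussSmooth h (x + √s * z) t ∂gaussianReal 0 1 := by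
  have hc := hh.continuous
  have hmap : ∀ (f : ℝ → ℝ), Continuous f → ∀ r : ℝ, 0 ≤ r →
      ∫ z, f (√r * z) ∂gaussianReal 0 1 = ∫ w, f w ∂gaussianReal 0 r.toNNReal := by
    intro f hf r hr
    rw [← map_sqrt_mul_stdGaussian hr, integral_map (by fun_prop) (by fun_prop)]
  have hU : Continuous fun w => gaussSmooth h w t := (lipschitzWith_gaussSmooth hh t).continuous
  have hi : Integrable (fun w => h (x + w)) (gaussianReal 0 (t + s).toNNReal) := by
    rw [← map_sqrt_mul_stdGaussian (add_nonneg ht hs),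
      integrable_map_measure (by fun_prop) (by fun_prop)]
    exact integrable_gaussSmooth hh x (t + s)
  rw [gaussSmooth, hmap (fun w => h (x + w)) (by fun_prop) _ (add_nonneg ht hs),
    hmap (fun w => gaussSmooth h (x + w) t) (by fun_prop) _ hs]
  have hconv : gaussianReal 0 (t + s).toNNReal
      = (gaussianReal 0 s.toNNReal).conv (gaussianReal 0 t.toNNReal) := by
    rw [gaussianReal_conv_gaussianReal, add_comm t s, Real.toNNReal_add hs ht, add_zero]
  rw [hconv] at hi ⊢
  rw [integral_conv hi]
  congr 1
  ext w
  rw [gaussSmooth, hmap (fun v => h (x + w + v)) (by fun_prop) t ht]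
  simp only [add_assoc]

/-- Third-order remainder estimate for Gaussian smoothing with variance `t`. -/
lemma abs_gaussSmooth_taylor_le (hh : LipschitzWith 1 h) {t : ℝ} (ht : 0 < t) (x y : ℝ) :
    |gaussSmooth h (x + y) t - gaussSmooth h x t
      - y * ((√t)⁻¹ * ∫ z, h (x + √t * z) * z ∂gaussianReal 0 1)
      - y ^ 2 * ((2 * t)⁻¹ * ∫ z, h (x + √t * z) * (z ^ 2 - 1) ∂gaussianReal 0 1)|
      ≤ |y| ^ 3 / (3 * t) := by
  have hst : 0 < √t := Real.sqrt_pos.2 ht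
  have hsq : √t * √t = t := Real.mul_self_sqrt ht.le
  have hg : LipschitzWith (NNReal.mk (√t) hst.le) (fun v => h (√t * v)) :=
    LipschitzWith.of_dist_le_mul fun v w => by
      have := hh.abs_sub_le (√t * v) (√t * w)
      rw [← mul_sub, abs_mul, abs_of_pos hst] at this
      simpa [Real.dist_eq] using this
  have e : ∀ w z : ℝ, √t * (w / √t + z) = w + √t * z := fun w z => by field_simp
  have key := hg.abs_stdGaussian_smoothing_taylor_le (x / √t) (y / √t)
  simp only [← add_div, e] at key
  simp only [gaussSmooth]
  convert key using 1
  · congr 2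
    · rw [div_eq_mul_inv, mul_assoc]
    · rw [div_pow, Real.sq_sqrt ht.le]
      field_simp
  · rw [abs_div, abs_of_pos hst, NNReal.coe_mk]
    field_simp
    rw [Real.sq_sqrt ht.le]

lemma abs_integral_gaussSmooth_le (hh : LipschitzWith 1 h) {p : ℝ → ℝ} (hp : Continuous p)
    (hp2 : ∀ v, |p v| ≤ 1 + v ^ 2) (hp0 : ∫ z, p z ∂gaussianReal 0 1 = 0) (x t : ℝ) :
    |∫ z, h (x + √t * z) * p z ∂gaussianReal 0 1|
      ≤ √t * ∫ z, |z| * |p z| ∂gaussianReal 0 1 := by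
  have hpi : Integrable p (gaussianReal 0 1) :=
    ((integrable_const (1 : ℝ)).add (integrable_pow_stdGaussian 2)).mono' (by fun_prop)
      (Filter.Eventually.of_forall hp2)
  have h1 : ∫ z, h (x + √t * z) * p z ∂gaussianReal 0 1
      = ∫ z, (h (x + √t * z) - h x) * p z ∂gaussianReal 0 1 := by
    simp only [sub_mul]
    rw [integral_sub (hh.integrable_mul_stdGaussian hp hp2 x √t) (hpi.const_mul _),
      integral_const_mul, hp0]
    simp
  have hi : Integrable (fun z : ℝ => |z| * |p z|) (gaussianReal 0 1) := by
    refine ((integrable_abs_pow_stdGaussian 1).add (integrable_abs_pow_stdGaussian 3)).mono'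
      (by fun_prop) (Filter.Eventually.of_forall fun z => ?_)
    rw [norm_mul, Real.norm_eq_abs, abs_abs, Real.norm_eq_abs, abs_abs]
    have := mul_le_mul_of_nonneg_left (hp2 z) (abs_nonneg z)
    rw [← sq_abs z] at this
    simp only [Pi.add_apply]
    nlinarith
  rw [h1, ← integral_const_mul, ← Real.norm_eq_abs]
  refine norm_integral_le_of_norm_le (hi.const_mul _) (Filter.Eventually.of_forall fun z => ?_)
  rw [norm_mul, Real.norm_eq_abs, Real.norm_eq_abs, ← mul_assoc]
  refine mul_le_mul_of_nonneg_right ?_ (abs_nonneg _)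
  simpa [abs_mul, abs_of_nonneg (Real.sqrt_nonneg t)] using hh.abs_sub_le (x + √t * z) x

/-- Replacing a Gaussian increment of variance `s` by an arbitrary increment, up to terms that
vanish in mean for increments with mean `0` and variance `s`. -/
lemma exists_gaussSmooth_sub_le (hh : LipschitzWith 1 h) {α : ℝ} (hα : 0 < α) :
    ∃ C : ℝ, ∃ A B : ℝ × ℝ × ℝ → ℝ, Measurable A ∧ Measurable B ∧
      ∀ x t s : ℝ, 0 ≤ t → α ≤ s → |A (x, t, s)| ≤ C ∧ |B (x, t, s)| ≤ C ∧
        ∀ y, gaussSmooth h (x + y) t - gaussSmooth h x (t + s)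
          ≤ y * A (x, t, s) + (y ^ 2 - s) * B (x, t, s) + 3 * |y| ^ 3 / (t + s) := by
  set a : ℝ × ℝ → ℝ := fun q => (√q.2)⁻¹ * ∫ z, h (q.1 + √q.2 * z) * z ∂gaussianReal 0 1 with ha
  set b : ℝ × ℝ → ℝ := fun q =>
    (2 * q.2)⁻¹ * ∫ z, h (q.1 + √q.2 * z) * (z ^ 2 - 1) ∂gaussianReal 0 1 with hb
  have ham : Measurable a :=
    (by fun_prop : Measurable fun q : ℝ × ℝ => (√q.2)⁻¹).mul
      (measurable_integral_gaussSmooth hh continuous_id)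
  have hbm : Measurable b :=
    (by fun_prop : Measurable fun q : ℝ × ℝ => (2 * q.2)⁻¹).mul
      (measurable_integral_gaussSmooth hh (by fun_prop))
  set M₁ := ∫ z : ℝ, |z| * |z| ∂gaussianReal 0 1
  set M₂ := ∫ z : ℝ, |z| * |z ^ 2 - 1| ∂gaussianReal 0 1
  have hM₁ : 0 ≤ M₁ := integral_nonneg fun z => by positivity
  have hM₂ : 0 ≤ M₂ := integral_nonneg fun z => by positivity
  have hsα : 0 < √α := Real.sqrt_pos.2 hα
  refine ⟨M₁ + M₂ / √(α / 2) + 4 / √α,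
    fun r => if r.2.2 / 2 ≤ r.2.1 then a (r.1, r.2.1) else 0,
    fun r => if r.2.2 / 2 ≤ r.2.1 then b (r.1, r.2.1) - 3 * √r.2.2 / (r.2.1 + r.2.2)
      else -(15 / 4 * √r.2.2 / (r.2.1 + r.2.2)), ?_, ?_, ?_⟩
  · exact Measurable.ite (measurableSet_le (by fun_prop) (by fun_prop)) (by fun_prop) (by fun_prop)
  · exact Measurable.ite (measurableSet_le (by fun_prop) (by fun_prop)) (by fun_prop) (by fun_prop)
  intro x t s ht hs
  have hs0 : 0 < s := hα.trans_le hs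
  have hss : 0 < √s := Real.sqrt_pos.2 hs0
  have hs2 : √s ^ 2 = s := Real.sq_sqrt hs0.le
  have hq : √s / (t + s) ≤ 1 / √α := by
    rw [div_le_div_iff₀ (by linarith) hsα]
    have := Real.sqrt_le_sqrt hs
    nlinarith
  have hq0 : 0 ≤ √s / (t + s) := by positivity
  have hcube : ∀ y : ℝ, √s ^ 3 ≤ |y| ^ 3 - 3 / 2 * √s * (y ^ 2 - s) := fun y => by
    rw [← sq_abs y]
    nth_rewrite 3 [← hs2]
    nlinarith [mul_nonneg (sq_nonneg (|y| - √s)) (by positivity : 0 ≤ |y| + √s / 2)]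
  have hα2 : 0 ≤ M₂ / √(α / 2) := by positivity
  have hα4 : 0 ≤ 4 / √α := by positivity
  by_cases hd : s / 2 ≤ t
  · have ht0 : 0 < t := by linarith
    have hst : 0 < √t := Real.sqrt_pos.2 ht0
    simp only [if_pos hd]
    have hab : |a (x, t)| ≤ M₁ := by
      have := abs_integral_gaussSmooth_le hh (p := fun z => z) continuous_id (fun v => by
        rw [← sq_abs]; nlinarith [sq_nonneg (|v| - 1), abs_nonneg v]) integral_id_gaussianReal x t
      rw [ha, abs_mul, abs_of_pos (inv_pos.2 hst)]
      rwa [inv_mul_le_iff₀ hst]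
    have hbb : |b (x, t)| ≤ M₂ / √(α / 2) := by
      have := abs_integral_gaussSmooth_le hh (p := fun z => z ^ 2 - 1) (by fun_prop) (fun v => by
        rw [abs_le]; constructor <;> nlinarith [sq_nonneg v]) (by
          rw [integral_sub (integrable_pow_stdGaussian 2) (integrable_const 1),
            integral_sq_stdGaussian]
          simp) x t
      have hle : √(α / 2) ≤ √t := Real.sqrt_le_sqrt (by linarith)
      calc |b (x, t)| ≤ (2 * t)⁻¹ * (√t * M₂) := by
            rw [hb, abs_mul, abs_of_pos (by positivity)]
            gcongr
        _ = M₂ / √t / 2 := by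
            field_simp
            rw [Real.sq_sqrt ht]
        _ ≤ M₂ / √t := half_le_self (by positivity)
        _ ≤ M₂ / √(α / 2) := by gcongr
    refine ⟨by linarith, ?_, fun y => ?_⟩
    · refine (abs_sub _ _).trans ?_
      rw [mul_div_assoc, abs_of_nonneg (by positivity : 0 ≤ 3 * (√s / (t + s)))]
      have : 3 * (√s / (t + s)) ≤ 4 / √α := by
        rw [← mul_one_div 4]
        linarith
      linarith
    · have h1 := (abs_le.1 (abs_gaussSmooth_taylor_le hh ht0 x y)).2
      have h2 : gaussSmooth h x t + s * b (x, t) - 2 * √s ^ 3 / (3 * t)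
          ≤ gaussSmooth h x (t + s) := by
        rw [gaussSmooth_add hh x ht hs0.le]
        have i1 : Integrable (fun z : ℝ => √s * a (x, t) * z) (gaussianReal 0 1) := by
          simpa using (integrable_pow_stdGaussian 1).const_mul (√s * a (x, t))
        have i2 : Integrable (fun z : ℝ => s * b (x, t) * z ^ 2) (gaussianReal 0 1) :=
          (integrable_pow_stdGaussian 2).const_mul _
        have i3 : Integrable (fun z : ℝ => √s ^ 3 / (3 * t) * |z| ^ 3) (gaussianReal 0 1) :=
          (integrable_abs_pow_stdGaussian 3).const_mul _
        have i4 : Integrable (fun z : ℝ => gaussSmooth h x t + √s * a (x, t) * z)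
          (gaussianReal 0 1) := (integrable_const _).add i1
        have hle := integral_mono ((i4.add i2).sub i3)
          ((lipschitzWith_gaussSmooth hh t).integrable_stdGaussian x √s) fun z => by
            have := (abs_le.1 (abs_gaussSmooth_taylor_le hh ht0 x (√s * z))).1
            rw [abs_mul, abs_of_pos hss, mul_pow (√s) z 2, hs2, mul_pow, mul_div_right_comm] at this
            simp only [Pi.sub_apply, Pi.add_apply, ha, hb]
            linarith
        rw [integral_sub' (i4.add i2) i3, integral_add' i4 i2,
          integral_add (integrable_const _) i1, integral_const_mul, integral_const_mul,
          integral_const_mul, integral_id_gaussianReal, integral_sq_stdGaussian] at hle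
        have h3 : √s ^ 3 / (3 * t) * ∫ z : ℝ, |z| ^ 3 ∂gaussianReal 0 1
            ≤ √s ^ 3 / (3 * t) * 2 :=
          mul_le_mul_of_nonneg_left integral_abs_pow_three_stdGaussian_le (by positivity)
        have h4 : 2 * √s ^ 3 / (3 * t) = √s ^ 3 / (3 * t) * 2 := by ring
        simp at hle
        linarith
      have h5 : |y| ^ 3 / (3 * t) + 2 * √s ^ 3 / (3 * t) ≤ (|y| ^ 3 + 2 * √s ^ 3) / (t + s) := by
        rw [← add_div]
        gcongr
        linarith
      have h6 : (|y| ^ 3 + 2 * √s ^ 3) / (t + s)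
          ≤ (3 * |y| ^ 3 - 3 * √s * (y ^ 2 - s)) / (t + s) := by
        gcongr
        linarith [hcube y]
      have h7 : (3 * |y| ^ 3 - 3 * √s * (y ^ 2 - s)) / (t + s)
          = 3 * |y| ^ 3 / (t + s) - (y ^ 2 - s) * (3 * √s / (t + s)) := by ring
      simp only [ha, hb] at h1 h2 ⊢
      linarith
  · simp only [if_neg hd]
    push Not at hd
    refine ⟨by simp; positivity, ?_, fun y => ?_⟩
    · rw [abs_neg, mul_div_assoc, abs_of_nonneg (by positivity)]
      have : 15 / 4 * (√s / (t + s)) ≤ 4 / √α := by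
        rw [← mul_one_div 4]
        linarith
      linarith
    · have h1 := (abs_le.1 (abs_gaussSmooth_sub_le hh (x + y) x t)).2
      have h2 : gaussSmooth h x t - √s ≤ gaussSmooth h x (t + s) := by
        rw [gaussSmooth_add hh x ht hs0.le]
        have := (abs_le.1
          (abs_gaussSmooth_sub_self_le (lipschitzWith_gaussSmooth hh t) x s)).1
        rw [gaussSmooth] at this
        linarith
      rw [add_sub_cancel_left] at h1
      have h3 : |y| + √s ≤ (|y| ^ 3 + 5 * √s ^ 3) / (3 * s) := by
        rw [le_div_iff₀ (by positivity)]
        nth_rewrite 2 [← hs2]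
        nlinarith [mul_nonneg (sq_nonneg (|y| - √s)) (by positivity : 0 ≤ |y| + 2 * √s)]
      have h4 : (|y| ^ 3 + 5 * √s ^ 3) / (3 * s) ≤ (|y| ^ 3 + 5 * √s ^ 3) / (2 * (t + s)) := by
        refine div_le_div_of_nonneg_left (by positivity) (by positivity) ?_
        linarith
      have h5 : (|y| ^ 3 + 5 * √s ^ 3) / (2 * (t + s))
          ≤ (6 * |y| ^ 3 - 15 / 2 * √s * (y ^ 2 - s)) / (2 * (t + s)) := by
        gcongr
        linarith [hcube y]
      have h6 : (6 * |y| ^ 3 - 15 / 2 * √s * (y ^ 2 - s)) / (2 * (t + s))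
          = (y ^ 2 - s) * -(15 / 4 * √s / (t + s)) + 3 * |y| ^ 3 / (t + s) := by
        field_simp
        ring
      linarith

end GaussSmooth

section Martingale

variable {Ω : Type*} {m : MeasurableSpace Ω} {μ : Measure Ω}

lemma integrable_sq_of_integrable_abs_pow_three {Y : Ω → ℝ} (hY : Integrable Y μ)
    (hY3 : Integrable (fun ω => |Y ω| ^ 3) μ) : Integrable (fun ω => Y ω ^ 2) μ := by
  refine (hY.abs.add hY3).mono' (hY.aestronglyMeasurable.pow 2)
    (Filter.Eventually.of_forall fun ω => ?_)
  rw [Real.norm_eq_abs, abs_of_nonneg (sq_nonneg _), ← sq_abs]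
  simp only [Pi.add_apply]
  nlinarith [mul_nonneg (abs_nonneg (Y ω)) (sq_nonneg (|Y ω| - 1)),
    mul_nonneg (abs_nonneg (Y ω)) (abs_nonneg (Y ω))]

variable [IsProbabilityMeasure μ]

lemma integrable_mul_and_integral_eq_zero_of_condExp {𝒢 : MeasurableSpace Ω} (h𝒢 : 𝒢 ≤ m)
    {D A : Ω → ℝ} {C : ℝ} (hD : Integrable D μ) (hD0 : μ[D | 𝒢] =ᵐ[μ] 0)
    (hA : Measurable[𝒢] A) (hAC : ∀ᵐ ω ∂μ, |A ω| ≤ C) :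
    Integrable (fun ω => D ω * A ω) μ ∧ ∫ ω, D ω * A ω ∂μ = 0 := by
  have hA' : StronglyMeasurable[𝒢] A := hA.stronglyMeasurable
  have hi : Integrable (D * A) μ :=
    hD.mul_bdd (hA.mono h𝒢 le_rfl).aestronglyMeasurable hAC
  refine ⟨hi, ?_⟩
  have h1 := condExp_mul_of_stronglyMeasurable_right (μ := μ) hA' hi hD
  have h2 : ∫ ω, (D * A) ω ∂μ = 0 := by
    rw [← integral_condExp h𝒢, integral_congr_ae (h1.trans (hD0.mul .rfl))]
    simp
  exact h2

lemma integrable_gaussSmooth_comp {h : ℝ → ℝ} (hh : LipschitzWith 1 h) {S T : Ω → ℝ}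
    (hS : Integrable S μ) (hT : Integrable T μ) :
    Integrable (fun ω => gaussSmooth h (S ω) (T ω)) μ := by
  refine Integrable.mono' (g := fun ω => |h 0| + |S ω| + (1 + |T ω|))
    (((integrable_const _).add hS.abs).add ((integrable_const _).add hT.abs)) ?_
    (Filter.Eventually.of_forall fun ω => ?_)
  · exact ((measurable_gaussSmooth hh).comp_aemeasurable
      (hS.aemeasurable.prodMk hT.aemeasurable)).aestronglyMeasurable
  · have h1 := abs_gaussSmooth_sub_self_le hh (S ω) (T ω)
    have h2 := hh.abs_sub_le (S ω) 0
    have h3 : √(T ω) ≤ 1 + |T ω| := by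
      rw [Real.sqrt_le_left (by positivity)]
      nlinarith [le_abs_self (T ω), abs_nonneg (T ω)]
    have h4 := abs_sub_abs_le_abs_sub (gaussSmooth h (S ω) (T ω)) (h (S ω))
    have h5 := abs_sub_abs_le_abs_sub (h (S ω)) (h 0)
    simp only [sub_zero, NNReal.coe_one, one_mul] at h2
    rw [Real.norm_eq_abs]
    linarith

/-- The cost of replacing one martingale difference by a Gaussian with the same conditional
variance, after Gaussian smoothing with conditionally known variance `T`. -/
lemma integral_gaussSmooth_martingale_step_le {h : ℝ → ℝ} (hh : LipschitzWith 1 h)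
    {𝒢 : MeasurableSpace Ω} (h𝒢 : 𝒢 ≤ m) {S T Y : Ω → ℝ} {α β : ℝ} (hα : 0 < α) (hβ : 0 < β)
    (hS : Measurable[𝒢] S) (hSi : Integrable S μ) (hT : Measurable[𝒢] T) (hTi : Integrable T μ)
    (hT0 : ∀ᵐ ω ∂μ, 0 ≤ T ω) (hY : Integrable Y μ) (hY3 : Integrable (fun ω => |Y ω| ^ 3) μ)
    (hY0 : μ[Y | 𝒢] =ᵐ[μ] 0) (hV : ∀ᵐ ω ∂μ, α ≤ μ[fun ω => Y ω ^ 2 | 𝒢] ω)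
    (hTV : ∀ᵐ ω ∂μ, β ≤ T ω + μ[fun ω => Y ω ^ 2 | 𝒢] ω) :
    ∫ ω, gaussSmooth h (S ω + Y ω) (T ω) ∂μ
      - ∫ ω, gaussSmooth h (S ω) (T ω + μ[fun ω => Y ω ^ 2 | 𝒢] ω) ∂μ
      ≤ 3 * (∫ ω, |Y ω| ^ 3 ∂μ) / β := by
  set V := μ[fun ω => Y ω ^ 2 | 𝒢] with hVdef
  have hY2 := integrable_sq_of_integrable_abs_pow_three hY hY3
  have hVm : StronglyMeasurable[𝒢] V := stronglyMeasurable_condExp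
  have hVi : Integrable V μ := integrable_condExp
  obtain ⟨C, A, B, hA, hB, hAB⟩ := exists_gaussSmooth_sub_le hh hα
  have hmeas : Measurable[𝒢] fun ω => (S ω, T ω, V ω) := hS.prodMk (hT.prodMk hVm.measurable)
  have hAB' : ∀ᵐ ω ∂μ, |A (S ω, T ω, V ω)| ≤ C ∧ |B (S ω, T ω, V ω)| ≤ C := by
    filter_upwards [hT0, hV] with ω h1 h2
    exact ⟨(hAB _ _ _ h1 h2).1, (hAB _ _ _ h1 h2).2.1⟩
  obtain ⟨i1, e1⟩ := integrable_mul_and_integral_eq_zero_of_condExp h𝒢 hY hY0 (hA.comp hmeas)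
    (hAB'.mono fun ω hω => hω.1)
  have hD0 : μ[fun ω => Y ω ^ 2 - V ω | 𝒢] =ᵐ[μ] 0 := by
    refine (condExp_sub hY2 hVi 𝒢).trans ?_
    rw [condExp_of_stronglyMeasurable h𝒢 hVm hVi, sub_self]
  have hYV : Integrable (fun ω => Y ω ^ 2 - V ω) μ := hY2.sub hVi
  obtain ⟨i2, e2⟩ := integrable_mul_and_integral_eq_zero_of_condExp h𝒢 hYV hD0
    (hB.comp hmeas) (hAB'.mono fun ω hω => hω.2)
  have i3 : Integrable (fun ω => 3 * |Y ω| ^ 3 / β) μ := (hY3.const_mul 3).div_const β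
  have j1 : Integrable (fun ω => gaussSmooth h (S ω + Y ω) (T ω)) μ :=
    integrable_gaussSmooth_comp hh (hSi.add hY) hTi
  have j2 : Integrable (fun ω => gaussSmooth h (S ω) (T ω + V ω)) μ :=
    integrable_gaussSmooth_comp hh hSi (hTi.add hVi)
  rw [← integral_sub j1 j2]
  refine (integral_mono_ae (j1.sub j2) ((i1.add i2).add i3) ?_).trans ?_
  · filter_upwards [hT0, hV, hTV] with ω h1 h2 h3
    refine ((hAB _ _ _ h1 h2).2.2 (Y ω)).trans ?_
    simp only [Pi.add_apply, Function.comp_apply]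
    gcongr
  · rw [integral_add' (i1.add i2) i3, integral_add' i1 i2, e1, e2, integral_div,
      integral_const_mul]
    simp

/-- One-sided version of the martingale central limit theorem for 1-Lipschitz test functions,
before normalisation. -/
lemma integral_martingale_sum_sub_gaussian_le {h : ℝ → ℝ} (hh : LipschitzWith 1 h) {n : ℕ}
    {ℱ : Filtration ℕ m} {Y : ℕ → Ω → ℝ} {α γ v : ℝ} (hα : 0 < α)
    (hadp : ∀ k < n, Measurable[ℱ (k + 1)] (Y k)) (hint : ∀ k < n, Integrable (Y k) μ)
    (hmds : ∀ k < n, μ[Y k | ℱ k] =ᵐ[μ] 0)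
    (hY3 : ∀ k < n, Integrable (fun ω => |Y k ω| ^ 3) μ)
    (hV : ∀ᵐ ω ∂μ, ∑ k ∈ range n, μ[fun ω => Y k ω ^ 2 | ℱ k] ω = v)
    (hlb : ∀ k < n, ∀ᵐ ω ∂μ, α ≤ μ[fun ω => Y k ω ^ 2 | ℱ k] ω)
    (hγ : ∀ k < n, ∫ ω, |Y k ω| ^ 3 ∂μ ≤ γ) :
    ∫ ω, h (∑ k ∈ range n, Y k ω) ∂μ - ∫ z, h (√v * z) ∂gaussianReal 0 1
      ≤ 3 * γ / α * ∑ k ∈ range n, ((k : ℝ) + 1)⁻¹ := by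
  set V : ℕ → Ω → ℝ := fun k => μ[fun ω => Y k ω ^ 2 | ℱ k] with hVdef
  set S : ℕ → Ω → ℝ := fun k ω => ∑ i ∈ range k, Y i ω with hSdef
  set T : ℕ → Ω → ℝ := fun k ω => v - ∑ i ∈ range k, V i ω with hTdef
  have hVm : ∀ k, Measurable[ℱ k] (V k) := fun k => stronglyMeasurable_condExp.measurable
  have hVi : ∀ k, Integrable (V k) μ := fun k => integrable_condExp
  have hSm : ∀ k ≤ n, Measurable[ℱ k] (S k) := fun k hk =>
    Finset.measurable_fun_sum _ fun i hi =>
      (hadp i ((mem_range.1 hi).trans_le hk)).mono (ℱ.mono (mem_range.1 hi)) le_rfl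
  have hSi : ∀ k ≤ n, Integrable (S k) μ := fun k hk =>
    integrable_finsetSum _ fun i hi => hint i ((mem_range.1 hi).trans_le hk)
  have hTm : ∀ k, Measurable[ℱ k] (T (k + 1)) := fun k =>
    measurable_const.sub (Finset.measurable_fun_sum _ fun i hi =>
      (hVm i).mono (ℱ.mono (Nat.lt_succ_iff.1 (mem_range.1 hi))) le_rfl)
  have hTi : ∀ k, Integrable (T k) μ := fun k =>
    (integrable_const v).sub (integrable_finsetSum _ fun i _ => hVi i)
  have hTV : ∀ k ω, T k ω = T (k + 1) ω + V k ω := fun k ω => by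
    simp only [hTdef, sum_range_succ]
    ring
  have hTlb : ∀ k ≤ n, ∀ᵐ ω ∂μ, ((n - k : ℕ) : ℝ) * α ≤ T k ω := by
    intro k hk
    have hall : ∀ᵐ ω ∂μ, ∀ i < n, α ≤ V i ω := by
      rw [ae_all_iff]
      intro i
      by_cases hi : i < n
      · filter_upwards [hlb i hi] with ω hω _ using hω
      · exact Filter.Eventually.of_forall fun ω h' => absurd h' hi
    filter_upwards [hV, hall] with ω h1 h2
    have h3 : T k ω = ∑ i ∈ Ico k n, V i ω := by
      rw [sum_Ico_eq_sub _ hk, h1]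
    rw [h3]
    have := card_nsmul_le_sum (Ico k n) (fun i => V i ω) α fun i hi => h2 i (mem_Ico.1 hi).2
    simpa using this
  have hstep : ∀ k < n, ∫ ω, gaussSmooth h (S (k + 1) ω) (T (k + 1) ω) ∂μ
      - ∫ ω, gaussSmooth h (S k ω) (T k ω) ∂μ ≤ 3 * γ / α * ((n - k : ℕ) : ℝ)⁻¹ := by
    intro k hk
    have hpos : (0 : ℝ) < ((n - k : ℕ) : ℝ) * α := by
      have : (0 : ℝ) < ((n - k : ℕ) : ℝ) := by exact_mod_cast Nat.sub_pos_of_lt hk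
      positivity
    have := integral_gaussSmooth_martingale_step_le hh (ℱ.le k) hα hpos (hSm k hk.le)
      (hSi k hk.le) (hTm k) (hTi (k + 1))
      ((hTlb (k + 1) hk).mono fun ω hω => le_trans (by positivity) hω) (hint k hk) (hY3 k hk)
      (hmds k hk) (hlb k hk) ((hTlb k hk.le).mono fun ω hω => hω.trans_eq (hTV k ω))
    calc _ = ∫ ω, gaussSmooth h (S k ω + Y k ω) (T (k + 1) ω) ∂μ
          - ∫ ω, gaussSmooth h (S k ω) (T (k + 1) ω + V k ω) ∂μ := by
          simp only [hTV k, hSdef, sum_range_succ]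
      _ ≤ _ := this
      _ ≤ 3 * γ / (((n - k : ℕ) : ℝ) * α) := by
          gcongr
          exact hγ k hk
      _ = _ := by
          rw [mul_comm _ α, ← div_div, div_eq_mul_inv (3 * γ / α)]
  have htel := sum_range_sub (fun k => ∫ ω, gaussSmooth h (S k ω) (T k ω) ∂μ) n
  have hsum : ∑ k ∈ range n, ((n - k : ℕ) : ℝ)⁻¹ = ∑ k ∈ range n, ((k : ℝ) + 1)⁻¹ := by
    rw [← sum_range_reflect]
    refine sum_congr rfl fun k hk => ?_
    have hk' := mem_range.1 hk
    have : n - (n - 1 - k) = k + 1 := by omega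
    rw [this]
    push_cast
    rfl
  have hend : ∫ ω, gaussSmooth h (S n ω) (T n ω) ∂μ = ∫ ω, h (S n ω) ∂μ := by
    refine integral_congr_ae ?_
    filter_upwards [hV] with ω hω
    have : T n ω = 0 := sub_eq_zero.2 hω.symm
    rw [this, gaussSmooth_zero]
  have hstart : ∫ ω, gaussSmooth h (S 0 ω) (T 0 ω) ∂μ
      = ∫ z, h (√v * z) ∂gaussianReal 0 1 := by
    simp [hSdef, hTdef, gaussSmooth]
  rw [← hend, ← hstart, ← htel, ← hsum, mul_sum]
  exact sum_le_sum fun k hk => hstep k (mem_range.1 hk)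

end Martingale

/-- One-sided bound in the martingale central limit theorem, after normalisation. -/
lemma integral_martingale_sum_div_sub_gaussian_le {Ω : Type*} {m : MeasurableSpace Ω}
    {μ : Measure Ω} [IsProbabilityMeasure μ] {h : ℝ → ℝ} (hh : LipschitzWith 1 h) {n : ℕ}
    (hn : 1 ≤ n) {ℱ : Filtration ℕ m} {Y : ℕ → Ω → ℝ} {α γ s : ℝ} (hα : 0 < α) (hs : 0 ≤ s)
    (hadp : ∀ k < n, Measurable[ℱ (k + 1)] (Y k)) (hint : ∀ k < n, Integrable (Y k) μ)
    (hmds : ∀ k < n, μ[Y k | ℱ k] =ᵐ[μ] 0)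
    (hY3 : ∀ k < n, Integrable (fun ω => |Y k ω| ^ 3) μ)
    (hV : ∀ᵐ ω ∂μ, ∑ k ∈ range n, μ[fun ω => Y k ω ^ 2 | ℱ k] ω = s ^ 2)
    (hlb : ∀ k < n, ∀ᵐ ω ∂μ, α ≤ μ[fun ω => Y k ω ^ 2 | ℱ k] ω)
    (hγ : ∀ k < n, ∫ ω, |Y k ω| ^ 3 ∂μ ≤ γ) :
    ∫ ω, h ((∑ k ∈ range n, Y k ω) / s) ∂μ - ∫ z, h z ∂gaussianReal 0 1
      ≤ 3 * γ * (1 + Real.log n) / (α ^ ((3 : ℝ) / 2) * √n) := by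
  have hn0 : (0 : ℝ) < n := by exact_mod_cast hn
  have hγ0 : 0 ≤ γ := le_trans (integral_nonneg fun ω => by positivity) (hγ 0 hn)
  have hsn : n * α ≤ s ^ 2 := by
    have hall : ∀ᵐ ω ∂μ, ∀ i < n, α ≤ μ[fun ω => Y i ω ^ 2 | ℱ i] ω := by
      rw [ae_all_iff]
      intro i
      by_cases hi : i < n
      · filter_upwards [hlb i hi] with ω hω _ using hω
      · exact Filter.Eventually.of_forall fun ω h' => absurd h' hi
    obtain ⟨ω, h1, h2⟩ := (hV.and hall).exists
    rw [← h1]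
    have := card_nsmul_le_sum (range n) (fun i => μ[fun ω => Y i ω ^ 2 | ℱ i] ω) α
      fun i hi => h2 i (mem_range.1 hi)
    simpa using this
  have hle : √α * √n ≤ s := by
    rw [← Real.sqrt_mul hα.le, Real.sqrt_le_left hs, mul_comm]
    exact hsn
  have hαn : 0 < √α * √n := mul_pos (Real.sqrt_pos.2 hα) (Real.sqrt_pos.2 hn0)
  have hs0 : 0 < s := hαn.trans_le hle
  have hh' : LipschitzWith 1 fun x => s * h (x / s) := LipschitzWith.of_dist_le_mul fun x y => by
    have := mul_le_mul_of_nonneg_left (hh.abs_sub_le (x / s) (y / s)) hs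
    rw [← sub_div, abs_div, abs_of_pos hs0, NNReal.coe_one, one_mul,
      mul_div_cancel₀ _ hs0.ne'] at this
    rw [Real.dist_eq, Real.dist_eq, ← mul_sub, abs_mul, abs_of_pos hs0]
    simpa using this
  have key := integral_martingale_sum_sub_gaussian_le hh' hα hadp hint hmds hY3 hV hlb hγ
  simp only [Real.sqrt_sq hs, mul_div_cancel_left₀ _ hs0.ne', integral_const_mul] at key
  rw [← mul_sub] at key
  have hharm : ∑ k ∈ range n, ((k : ℝ) + 1)⁻¹ ≤ 1 + Real.log n := by
    have := harmonic_le_one_add_log n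
    rw [harmonic] at this
    push_cast at this
    exact this
  have hlog : 0 ≤ 1 + Real.log n := by
    have := Real.log_natCast_nonneg n
    linarith
  have hα32 : α ^ ((3 : ℝ) / 2) = α * √α := by
    rw [Real.sqrt_eq_rpow, show (3 : ℝ) / 2 = 1 + 1 / 2 by norm_num, Real.rpow_add hα,
      Real.rpow_one]
  rw [← le_div_iff₀' hs0] at key
  calc _ ≤ _ := key
    _ ≤ 3 * γ / α * (1 + Real.log n) / (√α * √n) := by gcongr
    _ = _ := by
      rw [hα32]
      field_simp

/-- **Corollary 1** (Röllin): if `V_n² = s_n²` a.s., the conditional variances are bounded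
below by `α > 0` and the third moments by `γ`, then
`d_W(L(S_n/s_n), N(0,1)) ≤ 3γ(1 + log n)/(α^{3/2} √n)`. -/
theorem mean_martingale_clt_wasserstein_rate
    {Ω : Type*} [m : MeasurableSpace Ω] {μ : Measure Ω} [IsProbabilityMeasure μ]
    (n : ℕ) (hn : 1 ≤ n)
    (ℱ : Filtration ℕ m)
    (X : ℕ → Ω → ℝ)
    -- martingale difference sequence:
    (hadp : ∀ k, 1 ≤ k → k ≤ n → StronglyMeasurable[ℱ k] (X k))
    (hint : ∀ k, 1 ≤ k → k ≤ n → Integrable (X k) μ)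
    (hmds : ∀ k, 1 ≤ k → k ≤ n → μ[X k | ℱ (k - 1)] =ᵐ[μ] 0)
    -- finite third moments:
    (hX3 : ∀ k, 1 ≤ k → k ≤ n → Integrable (fun ω => |X k ω| ^ 3) μ)
    -- conditional variances σ_k² = E(X_k²|F_{k-1}):
    (σ2 : ℕ → Ω → ℝ)
    (hσ2 : ∀ k, σ2 k = μ[fun ω => (X k ω) ^ 2 | ℱ (k - 1)])
    -- s_n² = Var S_n = ∑ E X_i²:
    (sn : ℝ) (hsn0 : 0 ≤ sn)
    (hsn2 : sn ^ 2 = ∑ i ∈ Icc 1 n, ∫ ω, (X i ω) ^ 2 ∂μ)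
    -- assumption V_n² = s_n² a.s.:
    (hV : ∀ᵐ ω ∂μ, (∑ i ∈ Icc 1 n, σ2 i ω) = sn ^ 2)
    -- lower bound on conditional variances and upper bound on third moments:
    (α γ : ℝ) (hα : 0 < α)
    (hσlb : ∀ k, 1 ≤ k → k ≤ n → ∀ᵐ ω ∂μ, α ≤ σ2 k ω)
    (hγ : ∀ k, 1 ≤ k → k ≤ n → (∫ ω, |X k ω| ^ 3 ∂μ) ≤ γ)
    (h : ℝ → ℝ) (hh : LipschitzWith 1 h) :
    |(∫ ω, h ((∑ i ∈ Icc 1 n, X i ω) / sn) ∂μ) - ∫ x, h x ∂(gaussianReal 0 1)|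
      ≤ 3 * γ * (1 + Real.log n) / (α ^ ((3 : ℝ) / 2) * Real.sqrt n) := by
  have hk : ∀ k < n, 1 ≤ k + 1 ∧ k + 1 ≤ n := fun k hk => ⟨by omega, hk⟩
  have hre : ∀ f : ℕ → ℝ, ∑ i ∈ Icc 1 n, f i = ∑ k ∈ range n, f (k + 1) := fun f => by
    rw [range_eq_Ico, sum_Ico_add' f 0 n 1]
    rfl
  have hσ : ∀ k, σ2 (k + 1) = μ[fun ω => X (k + 1) ω ^ 2 | ℱ k] := fun k => hσ2 (k + 1)
  have main : ∀ {g : ℝ → ℝ}, LipschitzWith 1 g →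
      ∫ ω, g ((∑ i ∈ Icc 1 n, X i ω) / sn) ∂μ - ∫ z, g z ∂gaussianReal 0 1
        ≤ 3 * γ * (1 + Real.log n) / (α ^ ((3 : ℝ) / 2) * √n) := by
    intro g hg
    simp only [hre]
    refine integral_martingale_sum_div_sub_gaussian_le hg hn (ℱ := ℱ)
      (Y := fun k => X (k + 1)) hα hsn0
      (fun k h' => (hadp _ (hk k h').1 (hk k h').2).measurable)
      (fun k h' => hint _ (hk k h').1 (hk k h').2) (fun k h' => hmds _ (hk k h').1 (hk k h').2)
      (fun k h' => hX3 _ (hk k h').1 (hk k h').2) ?_ (fun k h' => ?_)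
      (fun k h' => hγ _ (hk k h').1 (hk k h').2)
    · simpa only [hre, hσ] using hV
    · simpa only [hσ] using hσlb _ (hk k h').1 (hk k h').2
  have h1 := main hh
  have h2 := main hh.neg
  simp only [Pi.neg_apply, integral_neg] at h2
  rw [abs_le]
  constructor <;> linarith
end

section
/- Assume that V_n² = s_n² almost surely with s_n > 0, and that there exist constants β and δ such that E(|X_k|³ | F_{k-1}) ≤ min(β, δσ_k²) almost surely for all 1 ≤ k ≤ n. Then d_W(L(S_n/s_n), N(0,1)) ≤ 3δn(s_n²/n + β^{2/3})(1 + log n)/s_n³ + 2/√n. -/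
open MeasureTheory ProbabilityTheory Real Finset

lemma abs_le_pow_succ_of_abs_deriv_le {f f' : ℝ → ℝ} {c : ℝ} (n : ℕ) (h0 : f 0 = 0)
    (hf : ∀ x, HasDerivAt f (f' x) x) (hb : ∀ x, |f' x| ≤ c * |x| ^ n) (x : ℝ) :
    |f x| ≤ c / (n + 1) * |x| ^ (n + 1) := by
  have key : ∀ (g g' : ℝ → ℝ), g 0 = 0 → (∀ x, HasDerivAt g (g' x) x) →
      (∀ x, |g' x| ≤ c * |x| ^ n) → ∀ x, 0 ≤ x → |g x| ≤ c / (n + 1) * |x| ^ (n + 1) := by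
    intro g g' hg0 hg hgb x hx
    have hB : ∀ y : ℝ, HasDerivAt (fun y => c / (n + 1) * y ^ (n + 1)) (c * y ^ n) y := by
      intro y
      have := (hasDerivAt_pow (n + 1) y).const_mul (c / (n + 1))
      refine this.congr_deriv ?_
      rw [Nat.add_sub_cancel, ← mul_assoc]
      push_cast
      rw [div_mul_cancel₀ _ (by positivity)]
    have := image_norm_le_of_norm_deriv_right_le_deriv_boundary (a := 0) (b := x) (f := g)
      (f' := g') (fun y _ => (hg y).continuousAt.continuousWithinAt)
      (fun y _ => (hg y).hasDerivWithinAt) (B := fun y => c / (n + 1) * y ^ (n + 1))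
      (by simp [hg0]) hB
      (fun y hy => by simpa [abs_of_nonneg hy.1] using hgb y) (Set.right_mem_Icc.2 hx)
    simpa [abs_of_nonneg hx] using this
  rcases le_total 0 x with hx | hx
  · exact key f f' h0 hf hb x hx
  · have := key (fun y => f (-y)) (fun y => -f' (-y)) (by simp [h0])
      (fun y => by
        refine ((hf (-y)).comp y (hasDerivAt_neg y)).congr_deriv ?_
        ring)
      (fun y => by simpa using hb (-y)) (-x) (by linarith)
    simpa using this

local notation "γ" => gaussianReal 0 1

lemma integrable_abs_pow_mul_exp_gaussianReal (k : ℕ) (v : ℝ) :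
    Integrable (fun z : ℝ => |z| ^ k * exp (v * z)) γ := by
  have := integrable_pow_abs_mul_exp_of_mem_interior_integrableExpSet (X := id) (μ := γ) (v := v)
    (by simp [integrableExpSet_id_gaussianReal]) k
  simpa using this

lemma integrable_abs_pow_gaussianReal (k : ℕ) : Integrable (fun z : ℝ => |z| ^ k) γ := by
  simpa using integrable_abs_pow_mul_exp_gaussianReal k 0

lemma integrable_pow_gaussianReal (k : ℕ) : Integrable (fun z : ℝ => z ^ k) γ := by
  refine (integrable_abs_pow_gaussianReal k).mono' (by fun_prop) ?_
  simp

lemma hasDerivAt_moment_gaussianReal (k : ℕ) (t : ℝ) :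
    HasDerivAt (fun t => ∫ z, z ^ k * exp (t * z) ∂γ) (∫ z, z ^ (k + 1) * exp (t * z) ∂γ) t := by
  have := hasDerivAt_integral_pow_mul_exp_real (X := id) (μ := γ) (t := t)
    (by simp [integrableExpSet_id_gaussianReal]) k
  simpa using this

lemma moments_gaussianReal : ∫ z, z ∂γ = 0 ∧ ∫ z, z ^ 2 ∂γ = 1 ∧ ∫ z, z ^ 4 ∂γ = 3 := by
  have e : ∀ t : ℝ, HasDerivAt (fun t : ℝ => exp (t ^ 2 / 2)) (t * exp (t ^ 2 / 2)) t := by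
    intro t
    have := ((hasDerivAt_pow 2 t).div_const 2).exp
    convert this using 1
    ring
  have m0 : (fun t => ∫ z, z ^ 0 * exp (t * z) ∂γ) = fun t => exp (t ^ 2 / 2) := by
    have := mgf_id_gaussianReal (μ := 0) (v := 1)
    ext t
    have := congrFun this t
    simpa [mgf] using this
  have m1 : (fun t => ∫ z, z ^ 1 * exp (t * z) ∂γ) = fun t => t * exp (t ^ 2 / 2) := by
    ext t
    have := hasDerivAt_moment_gaussianReal 0 t
    rw [m0] at this
    exact this.unique (e t)
  have m2 : (fun t => ∫ z, z ^ 2 * exp (t * z) ∂γ) = fun t => (1 + t ^ 2) * exp (t ^ 2 / 2) := by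
    ext t
    have := hasDerivAt_moment_gaussianReal 1 t
    rw [m1] at this
    refine this.unique (((hasDerivAt_id t).mul (e t)).congr_deriv ?_)
    simp only [id]; ring
  have m3 : (fun t => ∫ z, z ^ 3 * exp (t * z) ∂γ) =
      fun t => (3 * t + t ^ 3) * exp (t ^ 2 / 2) := by
    ext t
    have := hasDerivAt_moment_gaussianReal 2 t
    rw [m2] at this
    refine this.unique ((((hasDerivAt_pow 2 t).const_add 1).mul (e t)).congr_deriv ?_)
    simp; ring
  have m4 : ∫ z, z ^ 4 * exp (0 * z) ∂γ = 3 := by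
    have := hasDerivAt_moment_gaussianReal 3 0
    rw [m3] at this
    refine this.unique (((((hasDerivAt_id (0 : ℝ)).const_mul 3).add
      (hasDerivAt_pow 3 0)).mul (e 0)).congr_deriv ?_)
    simp
  refine ⟨?_, ?_, ?_⟩
  · simp
  · simpa using congrFun m2 0
  · simpa using m4

lemma integral_abs_gaussianReal_le : ∫ z, |z| ∂γ ≤ 1 := by
  have h : ∫ z, |z| ∂γ ≤ ∫ z, (1 + z ^ 2) / 2 ∂γ := by
    refine integral_mono (by simpa using integrable_abs_pow_gaussianReal 1)
      (((integrable_const _).add (integrable_pow_gaussianReal 2)).div_const 2) fun z => ?_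
    simp only
    nlinarith [sq_nonneg (|z| - 1), sq_abs z]
  rw [integral_div, integral_add (integrable_const _) (integrable_pow_gaussianReal 2),
    moments_gaussianReal.2.1] at h
  norm_num at h
  exact h

lemma integral_abs_cube_gaussianReal_le : ∫ z, |z| ^ 3 ∂γ ≤ 2 := by
  have h : ∫ z, |z| ^ 3 ∂γ ≤ ∫ z, (z ^ 2 + z ^ 4) / 2 ∂γ := by
    refine integral_mono (integrable_abs_pow_gaussianReal 3)
      (((integrable_pow_gaussianReal 2).add (integrable_pow_gaussianReal 4)).div_const 2)
      fun z => ?_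
    simp only
    have h2 : z ^ 2 = |z| ^ 2 := (sq_abs z).symm
    have h4 : z ^ 4 = |z| ^ 4 := (Even.pow_abs (by decide) z).symm
    rw [h2, h4]
    nlinarith [sq_nonneg (|z| * (|z| - 1))]
  rw [integral_div, integral_add (integrable_pow_gaussianReal 2) (integrable_pow_gaussianReal 4),
    moments_gaussianReal.2.1, moments_gaussianReal.2.2] at h
  linarith

lemma integral_gaussianReal_translate (F : ℝ → ℝ) (v : ℝ) :
    ∫ z, F (v + z) ∂γ = exp (-v ^ 2 / 2) * ∫ z, F z * exp (v * z) ∂γ := by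
  rw [integral_gaussianReal_eq_integral_smul one_ne_zero,
    integral_gaussianReal_eq_integral_smul one_ne_zero, ← integral_const_mul,
    ← integral_sub_right_eq_self _ v]
  congr 1
  ext z
  simp only [gaussianPDFReal, smul_eq_mul, add_sub_cancel, NNReal.coe_one, mul_one]
  have : exp (-(z - v - 0) ^ 2 / 2) = exp (-v ^ 2 / 2) * exp (v * z) * exp (-(z - 0) ^ 2 / 2) := by
    rw [← exp_add, ← exp_add]; congr 1; ring
  rw [this]; ring

section Lipschitz

variable {H : ℝ → ℝ} {K : ℝ}

lemma continuous_of_abs_sub_le (hH : ∀ x y, |H x - H y| ≤ K * |x - y|) : Continuous H := by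
  have hK : 0 ≤ K := by simpa using (abs_nonneg _).trans (hH 1 0)
  exact (LipschitzWith.of_dist_le_mul (K := ⟨K, hK⟩) fun x y => by
    simp only [Real.dist_eq]; exact hH x y).continuous

lemma integrable_mul_pow_mul_exp_gaussianReal (hH : ∀ x y, |H x - H y| ≤ K * |x - y|)
    (k : ℕ) (v : ℝ) : Integrable (fun z => H z * z ^ k * exp (v * z)) γ := by
  have hc := continuous_of_abs_sub_le hH
  refine (((integrable_abs_pow_mul_exp_gaussianReal k v).const_mul |H 0|).add
    ((integrable_abs_pow_mul_exp_gaussianReal (k + 1) v).const_mul K)).mono'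
    (by fun_prop) (Filter.Eventually.of_forall fun z => ?_)
  have h1 : |H z| ≤ |H 0| + K * |z| := by
    have := hH z 0
    have h2 := abs_sub_abs_le_abs_sub (H z) (H 0)
    simp only [sub_zero] at this
    linarith
  simp only [norm_mul, norm_pow, Real.norm_eq_abs, abs_exp, Pi.add_apply]
  calc |H z| * |z| ^ k * exp (v * z) ≤ (|H 0| + K * |z|) * |z| ^ k * exp (v * z) := by gcongr
    _ = _ := by ring

lemma hasDerivAt_integral_mul_exp_gaussianReal (hH : ∀ x y, |H x - H y| ≤ K * |x - y|)
    (k : ℕ) (v : ℝ) : HasDerivAt (fun v => ∫ z, H z * z ^ k * exp (v * z) ∂γ)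
      (∫ z, H z * z ^ (k + 1) * exp (v * z) ∂γ) v := by
  have hc := continuous_of_abs_sub_le hH
  refine (hasDerivAt_integral_of_dominated_loc_of_deriv_le (μ := γ)
    (F := fun v z => H z * z ^ k * exp (v * z)) (F' := fun v z => H z * z ^ (k + 1) * exp (v * z))
    (bound := fun z => ‖H z * z ^ (k + 1) * exp ((v + 1) * z)‖ +
      ‖H z * z ^ (k + 1) * exp ((v - 1) * z)‖)
    (Metric.ball_mem_nhds v one_pos) (Filter.Eventually.of_forall fun w => by fun_prop)
    (integrable_mul_pow_mul_exp_gaussianReal hH k v) (by fun_prop) ?_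
    ((integrable_mul_pow_mul_exp_gaussianReal hH (k + 1) (v + 1)).norm.add
      (integrable_mul_pow_mul_exp_gaussianReal hH (k + 1) (v - 1)).norm) ?_).2
  · refine Filter.Eventually.of_forall fun z w hw => ?_
    rw [Metric.mem_ball, Real.dist_eq, abs_lt] at hw
    rw [norm_mul, norm_mul _ (exp ((v + 1) * z)), norm_mul _ (exp ((v - 1) * z)), ← mul_add]
    gcongr
    simp only [Real.norm_eq_abs, abs_exp]
    rcases le_total 0 z with hz | hz
    · have : exp (w * z) ≤ exp ((v + 1) * z) := exp_le_exp.2 (by nlinarith)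
      linarith [exp_pos ((v - 1) * z)]
    · have : exp (w * z) ≤ exp ((v - 1) * z) := exp_le_exp.2 (by nlinarith)
      linarith [exp_pos ((v + 1) * z)]
  · refine Filter.Eventually.of_forall fun z w _ => ?_
    have := (((hasDerivAt_id w).mul_const z).exp).const_mul (H z * z ^ k)
    refine this.congr_deriv ?_
    simp only [id]; ring

lemma integrable_translate_mul_pow_gaussianReal (hH : ∀ x y, |H x - H y| ≤ K * |x - y|)
    (k : ℕ) (v : ℝ) : Integrable (fun z => H (v + z) * z ^ k) γ := by
  have hH' : ∀ x y, |H (v + x) - H (v + y)| ≤ K * |x - y| := fun x y => by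
    simpa using hH (v + x) (v + y)
  simpa using integrable_mul_pow_mul_exp_gaussianReal hH' k 0

lemma hasDerivAt_gaussian_smoothing (hH : ∀ x y, |H x - H y| ≤ K * |x - y|) (v : ℝ) :
    HasDerivAt (fun v => ∫ z, H (v + z) ∂γ) (∫ z, H (v + z) * z ∂γ) v ∧
    HasDerivAt (fun v => ∫ z, H (v + z) * z ∂γ) (∫ z, H (v + z) * (z ^ 2 - 1) ∂γ) v := by
  set L : ℕ → ℝ → ℝ := fun k v => ∫ z, H z * z ^ k * exp (v * z) ∂γ with hL
  have hLd : ∀ k w, HasDerivAt (L k) (L (k + 1) w) w :=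
    hasDerivAt_integral_mul_exp_gaussianReal hH
  have hi := integrable_mul_pow_mul_exp_gaussianReal hH
  have e : ∀ t : ℝ, HasDerivAt (fun t : ℝ => exp (-t ^ 2 / 2)) (-t * exp (-t ^ 2 / 2)) t := by
    intro t
    have := (((hasDerivAt_pow 2 t).neg).div_const 2).exp
    refine this.congr_deriv ?_
    simp; ring
  have g0 : (fun v => ∫ z, H (v + z) ∂γ) = fun v => exp (-v ^ 2 / 2) * L 0 v := by
    ext w
    rw [integral_gaussianReal_translate]
    simp [hL]
  have g1 : (fun v => ∫ z, H (v + z) * z ∂γ) =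
      fun v => exp (-v ^ 2 / 2) * (L 1 v - v * L 0 v) := by
    ext w
    have := integral_gaussianReal_translate (fun z => H z * (z - w)) w
    simp only [add_sub_cancel_left] at this
    rw [this]
    simp only [hL]
    rw [← integral_const_mul w, ← integral_sub (hi 1 w) ((hi 0 w).const_mul w)]
    congr 2
    ext z; ring
  have g2 : (fun v => ∫ z, H (v + z) * (z ^ 2 - 1) ∂γ) =
      fun v => exp (-v ^ 2 / 2) * (L 2 v - 2 * v * L 1 v + (v ^ 2 - 1) * L 0 v) := by
    ext w
    have := integral_gaussianReal_translate (fun z => H z * ((z - w) ^ 2 - 1)) w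
    simp only [add_sub_cancel_left] at this
    rw [this]
    simp only [hL]
    rw [← integral_const_mul (2 * w), ← integral_const_mul (w ^ 2 - 1),
      ← integral_sub (hi 2 w) ((hi 1 w).const_mul (2 * w)),
      ← integral_add (by exact (hi 2 w).sub ((hi 1 w).const_mul (2 * w)))
        ((hi 0 w).const_mul (w ^ 2 - 1))]
    congr 2
    ext z; ring
  constructor
  · rw [g0, congrFun g1 v]
    refine ((e v).mul (hLd 0 v)).congr_deriv ?_
    ring
  · rw [g1, congrFun g2 v]
    refine ((e v).mul ((hLd 1 v).sub ((hasDerivAt_id v).mul (hLd 0 v)))).congr_deriv ?_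
    simp only [id, Pi.mul_apply, Pi.sub_apply]; ring

lemma gaussian_smoothing_second_lipschitz (hH : ∀ x y, |H x - H y| ≤ K * |x - y|) (v w : ℝ) :
    |∫ z, H (v + z) * (z ^ 2 - 1) ∂γ - ∫ z, H (w + z) * (z ^ 2 - 1) ∂γ| ≤ 2 * K * |v - w| := by
  have hi : ∀ v, Integrable (fun z => H (v + z) * (z ^ 2 - 1)) γ := fun v => by
    have := (integrable_translate_mul_pow_gaussianReal hH 2 v).sub
      (integrable_translate_mul_pow_gaussianReal hH 0 v)
    refine this.congr (Filter.Eventually.of_forall fun z => ?_)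
    simp only [Pi.sub_apply]; ring
  rw [← integral_sub (hi v) (hi w)]
  have h2 := (integrable_pow_gaussianReal 2).add (integrable_const (μ := γ) (1 : ℝ))
  have := norm_integral_le_of_norm_le (h2.const_mul (K * |v - w|))
    (f := fun z => H (v + z) * (z ^ 2 - 1) - H (w + z) * (z ^ 2 - 1))
    (Filter.Eventually.of_forall fun z => by
      rw [← sub_mul, norm_mul]
      have h1 := hH (v + z) (w + z)
      simp only [add_sub_add_right_eq_sub] at h1
      have h3 : |z ^ 2 - 1| ≤ z ^ 2 + 1 := abs_le.2 ⟨by nlinarith, by linarith⟩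
      simp only [Real.norm_eq_abs, Pi.add_apply]
      gcongr
      exact (abs_nonneg _).trans h1)
  rw [integral_const_mul] at this
  simp only [Pi.add_apply] at this
  rw [integral_add (integrable_pow_gaussianReal 2) (integrable_const _),
    moments_gaussianReal.2.1] at this
  norm_num at this
  linarith

lemma gaussian_smoothing_taylor (hH : ∀ x y, |H x - H y| ≤ K * |x - y|) (v y : ℝ) :
    |∫ z, H (v + y + z) ∂γ - ∫ z, H (v + z) ∂γ - y * ∫ z, H (v + z) * z ∂γ
      - y ^ 2 / 2 * ∫ z, H (v + z) * (z ^ 2 - 1) ∂γ| ≤ K / 3 * |y| ^ 3 := by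
  set G0 : ℝ → ℝ := fun v => ∫ z, H (v + z) ∂γ with hG0
  set G1 : ℝ → ℝ := fun v => ∫ z, H (v + z) * z ∂γ with hG1
  set G2 : ℝ → ℝ := fun v => ∫ z, H (v + z) * (z ^ 2 - 1) ∂γ with hG2
  have d0 : ∀ y, HasDerivAt (fun y => G0 (v + y)) (G1 (v + y)) y := fun y =>
    HasDerivAt.comp_const_add v y (hasDerivAt_gaussian_smoothing hH (v + y)).1
  have d1 : ∀ y, HasDerivAt (fun y => G1 (v + y)) (G2 (v + y)) y := fun y =>
    HasDerivAt.comp_const_add v y (hasDerivAt_gaussian_smoothing hH (v + y)).2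
  have b1 := abs_le_pow_succ_of_abs_deriv_le (c := 2 * K) 1
    (f := fun y => G1 (v + y) - G1 v - y * G2 v) (f' := fun y => G2 (v + y) - G2 v)
    (by simp) (fun y => by
      refine (((d1 y).sub_const (G1 v)).sub ((hasDerivAt_id y).mul_const (G2 v))).congr_deriv ?_
      ring)
    (fun y => by simpa using gaussian_smoothing_second_lipschitz hH (v + y) v)
  have b0 := abs_le_pow_succ_of_abs_deriv_le 2
    (f := fun y => G0 (v + y) - G0 v - y * G1 v - y ^ 2 / 2 * G2 v)
    (f' := fun y => G1 (v + y) - G1 v - y * G2 v) (c := 2 * K / ((1 : ℕ) + 1))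
    (by simp) (fun y => by
      refine ((((d0 y).sub_const (G0 v)).sub ((hasDerivAt_id y).mul_const (G1 v))).sub
        (((hasDerivAt_pow 2 y).div_const 2).mul_const (G2 v))).congr_deriv ?_
      simp) b1 y
  refine b0.trans (le_of_eq ?_)
  norm_num

end Lipschitz

/-- The expectation of `h (x + s Z)` for a standard normal variable `Z`. -/
noncomputable def gaussianSmoothing (h : ℝ → ℝ) (s x : ℝ) : ℝ := ∫ z, h (x + s * z) ∂γ

/-- The first derivative of `gaussianSmoothing h s` when `s` is positive. -/
noncomputable def gaussianSmoothingDeriv (h : ℝ → ℝ) (s x : ℝ) : ℝ :=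
  s⁻¹ * ∫ z, h (x + s * z) * z ∂γ

/-- The second derivative of `gaussianSmoothing h s` when `s` is positive. -/
noncomputable def gaussianSmoothingDeriv2 (h : ℝ → ℝ) (s x : ℝ) : ℝ :=
  (s ^ 2)⁻¹ * ∫ z, h (x + s * z) * (z ^ 2 - 1) ∂γ

section Smoothing

variable {h : ℝ → ℝ}

lemma LipschitzWith.abs_sub_le_of_one (hh : LipschitzWith 1 h) (x y : ℝ) :
    |h x - h y| ≤ 1 * |x - y| := by
  simpa [Real.dist_eq] using hh.dist_le_mul x y

lemma LipschitzWith.abs_sub_comp_const_mul_le (hh : LipschitzWith 1 h)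
    (s x : ℝ) (hs : 0 ≤ s) (y z : ℝ) :
    |h (x + s * y) - h (x + s * z)| ≤ s * |y - z| := by
  have := hh.abs_sub_le_of_one (x + s * y) (x + s * z)
  rwa [add_sub_add_left_eq_sub, ← mul_sub, abs_mul, abs_of_nonneg hs, one_mul] at this

lemma integrable_comp_mul_pow_gaussianReal (hh : LipschitzWith 1 h) (k : ℕ) (s x : ℝ) :
    Integrable (fun z => h (x + s * z) * z ^ k) γ := by
  have := integrable_mul_pow_mul_exp_gaussianReal (H := fun z => h (x + s * z)) (K := |s|)
    (fun y z => by
      have := hh.abs_sub_le_of_one (x + s * y) (x + s * z)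
      rwa [add_sub_add_left_eq_sub, ← mul_sub, abs_mul, one_mul] at this) k 0
  simpa using this

lemma integrable_comp_gaussianReal (hh : LipschitzWith 1 h) (s x : ℝ) :
    Integrable (fun z => h (x + s * z)) γ := by
  simpa using integrable_comp_mul_pow_gaussianReal hh 0 s x

lemma gaussianSmoothing_taylor (hh : LipschitzWith 1 h) {s : ℝ} (hs : 0 < s) (x y : ℝ) :
    |gaussianSmoothing h s (x + y) - gaussianSmoothing h s x - y * gaussianSmoothingDeriv h s x
      - y ^ 2 / 2 * gaussianSmoothingDeriv2 h s x| ≤ |y| ^ 3 / (3 * s ^ 2) := by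
  have := gaussian_smoothing_taylor (H := fun z => h (s * z)) (K := s)
    (fun y z => by simpa using hh.abs_sub_comp_const_mul_le s 0 hs.le y z) (x / s) (y / s)
  have e1 : ∀ z, s * (x / s + y / s + z) = x + y + s * z := fun z => by field_simp
  have e2 : ∀ z, s * (x / s + z) = x + s * z := fun z => by field_simp
  simp only [e1, e2] at this
  simp only [gaussianSmoothing, gaussianSmoothingDeriv, gaussianSmoothingDeriv2]
  rw [abs_div, abs_of_pos hs] at this
  convert this using 2
  · field_simp
  · field_simp

lemma abs_gaussianSmoothing_sub_le (hh : LipschitzWith 1 h) (s s' x : ℝ) :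
    |gaussianSmoothing h s x - gaussianSmoothing h s' x| ≤ |s - s'| := by
  simp only [gaussianSmoothing]
  rw [← integral_sub (integrable_comp_gaussianReal hh s x) (integrable_comp_gaussianReal hh s' x)]
  have := norm_integral_le_of_norm_le ((integrable_abs_pow_gaussianReal 1).const_mul |s - s'|)
    (f := fun z => h (x + s * z) - h (x + s' * z)) (Filter.Eventually.of_forall fun z => by
      have := hh.abs_sub_le_of_one (x + s * z) (x + s' * z)
      rw [add_sub_add_left_eq_sub, ← sub_mul, abs_mul, one_mul] at this
      simpa using this)
  rw [integral_const_mul] at this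
  simp only [pow_one, Real.norm_eq_abs] at this
  exact this.trans (mul_le_of_le_one_right (abs_nonneg _) integral_abs_gaussianReal_le)

lemma gaussianSmoothing_zero (x : ℝ) : gaussianSmoothing h 0 x = h x := by
  simp [gaussianSmoothing]

lemma abs_gaussianSmoothing_le (hh : LipschitzWith 1 h) (s x : ℝ) :
    |gaussianSmoothing h s x| ≤ |h 0| + |x| + |s| := by
  have h1 := abs_gaussianSmoothing_sub_le hh s 0 x
  rw [gaussianSmoothing_zero, sub_zero] at h1
  have h2 := hh.abs_sub_le_of_one x 0
  rw [sub_zero, one_mul] at h2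
  have h3 := abs_sub_abs_le_abs_sub (gaussianSmoothing h s x) (h x)
  have h4 := abs_sub_abs_le_abs_sub (h x) (h 0)
  linarith

lemma abs_gaussianSmoothingDeriv_le (hh : LipschitzWith 1 h) {s : ℝ} (hs : 0 < s) (x : ℝ) :
    |gaussianSmoothingDeriv h s x| ≤ 1 := by
  have e : ∫ z, h (x + s * z) * z ∂γ = ∫ z, (h (x + s * z) - h x) * z ∂γ := by
    simp only [sub_mul]
    rw [integral_sub (by simpa using integrable_comp_mul_pow_gaussianReal hh 1 s x)
      (by simpa using (integrable_pow_gaussianReal 1).const_mul (h x)), integral_const_mul,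
      moments_gaussianReal.1]
    simp
  have := norm_integral_le_of_norm_le ((integrable_pow_gaussianReal 2).const_mul s)
    (f := fun z => (h (x + s * z) - h x) * z) (Filter.Eventually.of_forall fun z => by
      have := hh.abs_sub_comp_const_mul_le s x hs.le z 0
      rw [mul_zero, add_zero, sub_zero] at this
      rw [norm_mul, Real.norm_eq_abs, Real.norm_eq_abs, ← sq_abs z]
      nlinarith [abs_nonneg z])
  rw [integral_const_mul, moments_gaussianReal.2.1, mul_one, Real.norm_eq_abs] at this
  rw [gaussianSmoothingDeriv, e, abs_mul, abs_of_pos (inv_pos.2 hs), inv_mul_le_iff₀ hs]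
  linarith

lemma abs_gaussianSmoothingDeriv2_le (hh : LipschitzWith 1 h) {s : ℝ} (hs : 0 < s) (x : ℝ) :
    |gaussianSmoothingDeriv2 h s x| ≤ 3 / s := by
  have e : ∫ z, h (x + s * z) * (z ^ 2 - 1) ∂γ = ∫ z, (h (x + s * z) - h x) * (z ^ 2 - 1) ∂γ := by
    have i1 : Integrable (fun z => h (x + s * z) * (z ^ 2 - 1)) γ := by
      refine ((integrable_comp_mul_pow_gaussianReal hh 2 s x).sub
        (integrable_comp_gaussianReal hh s x)).congr (Filter.Eventually.of_forall fun z => ?_)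
      simp only [Pi.sub_apply]; ring
    have i2 : Integrable (fun z : ℝ => z ^ 2 - 1) γ :=
      (integrable_pow_gaussianReal 2).sub (integrable_const _)
    have e2 : ∫ z : ℝ, (z ^ 2 - 1) ∂γ = 0 := by
      rw [integral_sub (integrable_pow_gaussianReal 2) (integrable_const _),
        moments_gaussianReal.2.1]
      simp
    simp only [sub_mul _ (h x)]
    rw [integral_sub i1 (i2.const_mul (h x)), integral_const_mul, e2]
    simp
  have hi := (integrable_abs_pow_gaussianReal 3).add (integrable_abs_pow_gaussianReal 1)
  have := norm_integral_le_of_norm_le (hi.const_mul s)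
    (f := fun z => (h (x + s * z) - h x) * (z ^ 2 - 1)) (Filter.Eventually.of_forall fun z => by
      have h1 := hh.abs_sub_comp_const_mul_le s x hs.le z 0
      rw [mul_zero, add_zero, sub_zero] at h1
      have h3 : |z ^ 2 - 1| ≤ |z| ^ 2 + 1 := by
        rw [sq_abs]; exact abs_le.2 ⟨by nlinarith, by linarith⟩
      rw [norm_mul, Real.norm_eq_abs, Real.norm_eq_abs]
      calc _ ≤ (s * |z|) * (|z| ^ 2 + 1) := by gcongr
        _ = _ := by simp only [Pi.add_apply]; ring)
  rw [integral_const_mul, Real.norm_eq_abs] at this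
  simp only [Pi.add_apply] at this
  rw [integral_add (integrable_abs_pow_gaussianReal 3) (integrable_abs_pow_gaussianReal 1)] at this
  simp only [pow_one] at this
  have h4 : |∫ z, (h (x + s * z) - h x) * (z ^ 2 - 1) ∂γ| ≤ s * 3 :=
    this.trans (by
      have := integral_abs_gaussianReal_le
      have := integral_abs_cube_gaussianReal_le
      gcongr; linarith)
  rw [gaussianSmoothingDeriv2, e, abs_mul, abs_of_pos (inv_pos.2 (pow_pos hs 2)),
    inv_mul_le_iff₀ (pow_pos hs 2)]
  refine h4.trans (le_of_eq ?_)
  field_simp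

lemma gaussianReal_eq_map_sqrt (t : NNReal) : gaussianReal 0 t = Measure.map (√(t : ℝ) * ·) γ := by
  rw [gaussianReal_map_const_mul]
  congr 1
  · simp
  · ext; simp

lemma gaussianSmoothing_sqrt_add (hh : LipschitzWith 1 h)
    {t u : ℝ} (ht : 0 ≤ t) (hu : 0 ≤ u) (x : ℝ) :
    gaussianSmoothing h √(t + u) x = ∫ w, gaussianSmoothing h √t (x + √u * w) ∂γ := by
  lift t to NNReal using ht
  lift u to NNReal using hu
  have key := gaussianReal_conv_gaussianReal (m₁ := 0) (m₂ := 0) (v₁ := u) (v₂ := t)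
  rw [zero_add, add_comm u t] at key
  have hc := hh.continuous
  have hx : Continuous fun z => h (x + z) := by fun_prop
  have hm : ∀ c : ℝ, AEMeasurable (fun z : ℝ => c * z) γ := fun c => by fun_prop
  have e1 : gaussianSmoothing h √((t : ℝ) + u) x = ∫ z, h (x + z) ∂(gaussianReal 0 (t + u)) := by
    rw [gaussianReal_eq_map_sqrt, integral_map (hm _) hx.aestronglyMeasurable]
    simp [gaussianSmoothing]
  have hint : Integrable (fun z => h (x + z)) (gaussianReal 0 (t + u)) := by
    rw [gaussianReal_eq_map_sqrt, integrable_map_measure hx.aestronglyMeasurable (hm _)]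
    exact integrable_comp_gaussianReal hh _ x
  rw [← key] at hint
  rw [e1, ← key, integral_conv hint]
  have e2 : ∀ y, ∫ z, h (x + (y + z)) ∂(gaussianReal 0 t) = gaussianSmoothing h √t (x + y) := by
    intro y
    have hy : Continuous fun z => h (x + (y + z)) := by fun_prop
    rw [gaussianReal_eq_map_sqrt, integral_map (hm _) hy.aestronglyMeasurable]
    simp [gaussianSmoothing, add_assoc]
  simp only [e2]
  have hmeas : StronglyMeasurable fun y => gaussianSmoothing h √t (x + y) := by
    unfold gaussianSmoothing
    apply StronglyMeasurable.integral_prod_right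
    exact Continuous.stronglyMeasurable (by simp only [Function.uncurry_def]; fun_prop)
  rw [gaussianReal_eq_map_sqrt u, integral_map (hm _) hmeas.aestronglyMeasurable]

lemma stronglyMeasurable_gaussianSmoothing_uncurry (hc : Continuous h) :
    StronglyMeasurable (fun p : ℝ × ℝ => gaussianSmoothing h p.1 p.2) ∧
    StronglyMeasurable (fun p : ℝ × ℝ => gaussianSmoothingDeriv h p.1 p.2) ∧
    StronglyMeasurable (fun p : ℝ × ℝ => gaussianSmoothingDeriv2 h p.1 p.2) := by
  have hi : Measurable fun p : ℝ × ℝ => p.1⁻¹ := by fun_prop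
  have hi2 : Measurable fun p : ℝ × ℝ => (p.1 ^ 2)⁻¹ := by fun_prop
  refine ⟨?_, hi.stronglyMeasurable.mul ?_, hi2.stronglyMeasurable.mul ?_⟩
  all_goals
    apply StronglyMeasurable.integral_prod_right
    exact Continuous.stronglyMeasurable (by simp only [Function.uncurry_def]; fun_prop)

lemma gaussianSmoothing_sqrt_add_sub_le (hh : LipschitzWith 1 h)
    {t u : ℝ} (ht : 0 < t) (hu : 0 ≤ u) (x : ℝ) :
    |gaussianSmoothing h √(t + u) x - gaussianSmoothing h √t x
      - u / 2 * gaussianSmoothingDeriv2 h √t x| ≤ 2 * √u ^ 3 / (3 * t) := by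
  have hs : 0 < √t := sqrt_pos.2 ht
  set g := gaussianSmoothing h √t with hg
  set d1 := gaussianSmoothingDeriv h √t x
  set d2 := gaussianSmoothingDeriv2 h √t x
  have hi : Integrable (fun w => g (x + √u * w)) γ := by
    have hm : StronglyMeasurable fun w => g (x + √u * w) :=
      (stronglyMeasurable_gaussianSmoothing_uncurry hh.continuous).1.comp_measurable
        (g := fun w : ℝ => ((√t, x + √u * w) : ℝ × ℝ)) (by fun_prop)
    refine ((integrable_const (|h 0| + |x| + |√t|)).add
      ((integrable_abs_pow_gaussianReal 1).const_mul √u)).mono' hm.aestronglyMeasurable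
      (Filter.Eventually.of_forall fun w => ?_)
    have h1 := abs_gaussianSmoothing_le hh √t (x + √u * w)
    have h2 := abs_add_le x (√u * w)
    rw [abs_mul, abs_of_nonneg (sqrt_nonneg u)] at h2
    simp only [Pi.add_apply, pow_one, Real.norm_eq_abs]
    linarith
  have hi1 : Integrable (fun w => √u * w * d1) γ := by
    simpa using ((integrable_pow_gaussianReal 1).const_mul √u).mul_const d1
  have hi2 : Integrable (fun w => (√u * w) ^ 2 / 2 * d2) γ := by
    have := (integrable_pow_gaussianReal 2).const_mul (√u ^ 2 / 2 * d2)
    refine this.congr (Filter.Eventually.of_forall fun w => ?_)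
    simp only; ring
  have e1 : ∫ w, √u * w * d1 ∂γ = 0 := by
    rw [integral_mul_const, integral_const_mul, moments_gaussianReal.1]; simp
  have e2 : ∫ w, (√u * w) ^ 2 / 2 * d2 ∂γ = u / 2 * d2 := by
    simp only [mul_pow, sq_sqrt hu]
    rw [integral_mul_const, integral_div, integral_const_mul, moments_gaussianReal.2.1]; simp
  have e : gaussianSmoothing h √(t + u) x - g x - u / 2 * d2 =
      ∫ w, (g (x + √u * w) - g x - √u * w * d1 - (√u * w) ^ 2 / 2 * d2) ∂γ := by
    rw [integral_sub (by exact (hi.sub (integrable_const (g x))).sub hi1) hi2,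
      integral_sub (by exact hi.sub (integrable_const (g x))) hi1,
      integral_sub hi (integrable_const _), e1, e2,
      ← gaussianSmoothing_sqrt_add hh ht.le hu]
    simp
  rw [e]
  have := norm_integral_le_of_norm_le
    ((integrable_abs_pow_gaussianReal 3).const_mul (√u ^ 3 / (3 * t)))
    (f := fun w => g (x + √u * w) - g x - √u * w * d1 - (√u * w) ^ 2 / 2 * d2)
    (Filter.Eventually.of_forall fun w => by
      refine (gaussianSmoothing_taylor hh hs x (√u * w)).trans (le_of_eq ?_)
      rw [abs_mul, abs_of_nonneg (sqrt_nonneg u), sq_sqrt ht.le]; ring)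
  rw [integral_const_mul] at this
  refine this.trans ?_
  calc _ ≤ √u ^ 3 / (3 * t) * 2 := by gcongr; exact integral_abs_cube_gaussianReal_le
    _ = _ := by ring

lemma gaussianSmoothing_replacement_le (hh : LipschitzWith 1 h)
    {t u : ℝ} (ht : 0 < t) (hu : 0 ≤ u) (x y : ℝ) :
    |gaussianSmoothing h √t (x + y) - gaussianSmoothing h √(t + u) x
      - gaussianSmoothingDeriv h √t x * y - gaussianSmoothingDeriv2 h √t x / 2 * (y ^ 2 - u)|
      ≤ (|y| ^ 3 + 2 * √u ^ 3) / (3 * t) := by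
  have h1 := gaussianSmoothing_taylor hh (sqrt_pos.2 ht) x y
  have h2 := gaussianSmoothing_sqrt_add_sub_le hh ht hu x
  rw [sq_sqrt ht.le] at h1
  rw [add_div]
  rw [abs_le] at *
  constructor <;> linarith

end Smoothing

lemma integrable_mul_and_integral_mul_condExp {Ω : Type*} {m m₀ : MeasurableSpace Ω}
    {μ : Measure Ω} [IsProbabilityMeasure μ] (hm : m ≤ m₀) {f g : Ω → ℝ} {c : ℝ}
    (hf : StronglyMeasurable[m] f) (hfc : ∀ᵐ ω ∂μ, |f ω| ≤ c) (hg : Integrable g μ) :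
    Integrable (fun ω => f ω * g ω) μ ∧ Integrable (fun ω => f ω * (μ[g | m]) ω) μ ∧
      ∫ ω, f ω * g ω ∂μ = ∫ ω, f ω * (μ[g | m]) ω ∂μ := by
  have hf' : AEStronglyMeasurable f μ := (hf.mono hm).aestronglyMeasurable
  refine ⟨hg.bdd_mul hf' hfc, integrable_condExp.bdd_mul hf' hfc, ?_⟩
  have := condExp_stronglyMeasurable_mul_of_bound hm hf hg c hfc
  rw [← integral_condExp hm (f := fun ω => f ω * g ω)]
  exact integral_congr_ae this

lemma integrable_sq_of_integrable_abs_cube {Ω : Type*} {m₀ : MeasurableSpace Ω}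
    {μ : Measure Ω} [IsProbabilityMeasure μ] {X : Ω → ℝ} (hX : Integrable X μ)
    (hX3 : Integrable (fun ω => |X ω| ^ 3) μ) : Integrable (fun ω => X ω ^ 2) μ := by
  refine ((integrable_const (1 : ℝ)).add hX3).mono' (hX.aestronglyMeasurable.pow 2)
    (Filter.Eventually.of_forall fun ω => ?_)
  simp only [norm_pow, Real.norm_eq_abs, Pi.add_apply]
  have := abs_nonneg (X ω)
  rcases le_total (|X ω|) 1 with h | h
  · nlinarith [pow_nonneg this 3]
  · nlinarith [pow_nonneg this 2]

lemma sqrt_condExp_sq_cube_le {Ω : Type*} {m m₀ : MeasurableSpace Ω}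
    {μ : Measure Ω} {X : Ω → ℝ}
    (hX3 : Integrable (fun ω => |X ω| ^ 3) μ) :
    ∀ᵐ ω ∂μ, √((μ[fun ω => X ω ^ 2 | m]) ω) ^ 3 ≤ (μ[fun ω => |X ω| ^ 3 | m]) ω := by
  have e : (fun ω => |X ω| ^ 3) = fun ω => ‖X ω ^ 2‖ ^ (3 / 2 : ℝ) := by
    ext ω
    rw [norm_pow, Real.norm_eq_abs, ← rpow_natCast, ← rpow_natCast, ← rpow_mul (abs_nonneg _)]
    norm_num
  rw [e] at hX3 ⊢
  have h0 : 0 ≤ᵐ[μ] μ[fun ω => X ω ^ 2 | m] :=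
    condExp_nonneg (Filter.Eventually.of_forall fun ω => sq_nonneg _)
  filter_upwards [Integrable.norm_condExp_rpow_le (m := m) (by norm_num) hX3, h0] with ω h1 h2
  refine le_trans (le_of_eq ?_) h1
  simp only [Pi.zero_apply] at h2
  rw [Real.norm_of_nonneg h2, sqrt_eq_rpow, ← rpow_natCast, ← rpow_mul h2]
  norm_num

lemma div_le_mul_log_sub_log {t u a b : ℝ} (ha : 0 < a) (hat : a ≤ t) (hu : 0 ≤ u) (hub : u ≤ b) :
    u / t ≤ (1 + b / a) * (log (t + u) - log t) := by
  have ht : 0 < t := ha.trans_le hat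
  have htu : 0 < t + u := by linarith
  have h1 : u / (t + u) ≤ log (t + u) - log t := by
    rw [← log_div htu.ne' ht.ne']
    refine le_trans (le_of_eq ?_) (one_sub_inv_le_log_of_pos (div_pos htu ht))
    field_simp; ring
  have hb : 0 ≤ b := hu.trans hub
  refine le_trans ?_ (mul_le_mul_of_nonneg_left h1 (by positivity))
  have h2 : t + u ≤ (1 + b / a) * t := by
    have : b ≤ b / a * t := by
      rw [div_mul_eq_mul_div, le_div_iff₀ ha]
      gcongr
    linarith
  rw [mul_div_assoc', div_le_div_iff₀ ht htu]
  nlinarith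

lemma gaussianSmoothing_martingale_step {Ω : Type*} {m m₀ : MeasurableSpace Ω}
    {μ : Measure Ω} [IsProbabilityMeasure μ] (hm : m ≤ m₀) {h : ℝ → ℝ} (hh : LipschitzWith 1 h)
    {X S T U : Ω → ℝ} (hX : Integrable X μ) (hX0 : μ[X | m] =ᵐ[μ] 0)
    (hX3 : Integrable (fun ω => |X ω| ^ 3) μ) (hS : StronglyMeasurable[m] S)
    (hSi : Integrable S μ) (hT : StronglyMeasurable[m] T) (hU : U = μ[fun ω => X ω ^ 2 | m])
    {a c β δ : ℝ} (ha : 0 < a) (hTa : ∀ᵐ ω ∂μ, a ≤ T ω) (hTc : ∀ᵐ ω ∂μ, T ω + U ω ≤ c)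
    (hβδ : μ[fun ω => |X ω| ^ 3 | m] ≤ᵐ[μ] fun ω => min β (δ * U ω)) (hδ : 0 ≤ δ) :
    |(∫ ω, gaussianSmoothing h √(T ω) (S ω + X ω) ∂μ)
        - ∫ ω, gaussianSmoothing h √(T ω + U ω) (S ω) ∂μ|
      ≤ δ * (1 + β ^ (2 / 3 : ℝ) / a) * ∫ ω, (log (T ω + U ω) - log (T ω)) ∂μ := by
  have hX2 := integrable_sq_of_integrable_abs_cube hX hX3
  have hUm : StronglyMeasurable[m] U := hU ▸ stronglyMeasurable_condExp
  have hU0 : ∀ᵐ ω ∂μ, 0 ≤ U ω := by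
    rw [hU]; exact condExp_nonneg (Filter.Eventually.of_forall fun ω => sq_nonneg _)
  have hJ : ∀ᵐ ω ∂μ, √(U ω) ^ 3 ≤ (μ[fun ω => |X ω| ^ 3 | m]) ω := by
    rw [hU]; exact sqrt_condExp_sq_cube_le hX3
  set M := μ[fun ω => |X ω| ^ 3 | m] with hM
  obtain ⟨gm0, gm1, gm2⟩ := stronglyMeasurable_gaussianSmoothing_uncurry hh.continuous
  have hTsq : Measurable[m] fun ω => √(T ω) := continuous_sqrt.measurable.comp hT.measurable
  have hTS : Measurable[m] fun ω => (√(T ω), S ω) := hTsq.prodMk hS.measurable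
  have D1m : StronglyMeasurable[m] fun ω => gaussianSmoothingDeriv h √(T ω) (S ω) :=
    gm1.comp_measurable hTS
  have D2m : StronglyMeasurable[m] fun ω => gaussianSmoothingDeriv2 h √(T ω) (S ω) / 2 :=
    (gm2.comp_measurable hTS).div stronglyMeasurable_const
  have Tim : StronglyMeasurable[m] fun ω => (T ω)⁻¹ := hT.measurable.inv.stronglyMeasurable
  have D1b : ∀ᵐ ω ∂μ, |gaussianSmoothingDeriv h √(T ω) (S ω)| ≤ 1 := by
    filter_upwards [hTa] with ω h1
    exact abs_gaussianSmoothingDeriv_le hh (sqrt_pos.2 (ha.trans_le h1)) _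
  have D2b : ∀ᵐ ω ∂μ, |gaussianSmoothingDeriv2 h √(T ω) (S ω) / 2| ≤ 3 / √a / 2 := by
    filter_upwards [hTa] with ω h1
    rw [abs_div, abs_two]
    have h0 : 0 < √a := sqrt_pos.2 ha
    have := abs_gaussianSmoothingDeriv2_le hh (sqrt_pos.2 (ha.trans_le h1)) (S ω)
    have h3 : 3 / √(T ω) ≤ 3 / √a := by gcongr
    linarith
  have Tib : ∀ᵐ ω ∂μ, |(T ω)⁻¹| ≤ a⁻¹ := by
    filter_upwards [hTa] with ω h1
    rw [abs_of_pos (inv_pos.2 (ha.trans_le h1))]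
    gcongr
  obtain ⟨i1, -, e1⟩ := integrable_mul_and_integral_mul_condExp hm D1m D1b hX
  obtain ⟨i2, i2', e2⟩ := integrable_mul_and_integral_mul_condExp hm D2m D2b hX2
  obtain ⟨i3, i3', e3⟩ := integrable_mul_and_integral_mul_condExp hm Tim Tib hX3
  rw [← hU] at i2' e2
  rw [← hM] at i3' e3
  have e1' : ∫ ω, gaussianSmoothingDeriv h √(T ω) (S ω) * X ω ∂μ = 0 := by
    rw [e1]
    refine integral_eq_zero_of_ae ?_
    filter_upwards [hX0] with ω h1
    simp [h1]
  have P1i : Integrable (fun ω => gaussianSmoothing h √(T ω) (S ω + X ω)) μ := by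
    refine (((integrable_const (|h 0| + √c)).add hSi.abs).add hX.abs).mono'
      (gm0.measurable.comp_aemeasurable (f := fun ω => (√(T ω), S ω + X ω))
        ((hTsq.mono hm le_rfl).aemeasurable.prodMk
          (hSi.add hX).aemeasurable)).aestronglyMeasurable ?_
    filter_upwards [hTc, hU0] with ω h1 h2
    have h3 := abs_gaussianSmoothing_le hh √(T ω) (S ω + X ω)
    have h4 := abs_add_le (S ω) (X ω)
    have h5 : √(T ω) ≤ √c := by gcongr; linarith
    rw [abs_of_nonneg (sqrt_nonneg _)] at h3
    simp only [Pi.add_apply, Real.norm_eq_abs]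
    linarith
  have P2i : Integrable (fun ω => gaussianSmoothing h √(T ω + U ω) (S ω)) μ := by
    refine ((integrable_const (|h 0| + √c)).add hSi.abs).mono'
      (gm0.comp_measurable (g := fun ω => (√(T ω + U ω), S ω))
        (((continuous_sqrt.measurable.comp (hT.add hUm).measurable).mono hm le_rfl).prodMk
          (hS.mono hm).measurable)).aestronglyMeasurable ?_
    filter_upwards [hTc] with ω h1
    have h3 := abs_gaussianSmoothing_le hh √(T ω + U ω) (S ω)
    have h5 : √(T ω + U ω) ≤ √c := by gcongr
    rw [abs_of_nonneg (sqrt_nonneg _)] at h3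
    simp only [Pi.add_apply, Real.norm_eq_abs]
    linarith
  have e : (∫ ω, gaussianSmoothing h √(T ω) (S ω + X ω) ∂μ)
        - ∫ ω, gaussianSmoothing h √(T ω + U ω) (S ω) ∂μ =
      ∫ ω, (gaussianSmoothing h √(T ω) (S ω + X ω) - gaussianSmoothing h √(T ω + U ω) (S ω)
        - gaussianSmoothingDeriv h √(T ω) (S ω) * X ω
        - (gaussianSmoothingDeriv2 h √(T ω) (S ω) / 2 * X ω ^ 2
          - gaussianSmoothingDeriv2 h √(T ω) (S ω) / 2 * U ω)) ∂μ := by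
    rw [integral_sub (by exact (P1i.sub P2i).sub i1) (by exact i2.sub i2'),
      integral_sub (by exact P1i.sub P2i) i1, integral_sub P1i P2i, integral_sub i2 i2', e1', e2]
    simp
  have logi : Integrable (fun ω => log (T ω + U ω) - log (T ω)) μ := by
    refine (integrable_const (log c - log a)).mono'
      (((measurable_log.comp (hT.add hUm).measurable).sub
        (measurable_log.comp hT.measurable)).mono hm le_rfl).aestronglyMeasurable ?_
    filter_upwards [hTa, hTc, hU0] with ω h1 h2 h3
    have h4 : log a ≤ log (T ω) := log_le_log ha h1
    have h5 : log (T ω) ≤ log (T ω + U ω) := log_le_log (by linarith) (by linarith)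
    have h6 : log (T ω + U ω) ≤ log c := log_le_log (by linarith) h2
    rw [Real.norm_of_nonneg (by linarith)]
    linarith
  rw [e]
  have key := norm_integral_le_of_norm_le ((i3.div_const 3).add (i3'.const_mul (2 / 3)))
    (f := fun ω => gaussianSmoothing h √(T ω) (S ω + X ω) - gaussianSmoothing h √(T ω + U ω) (S ω)
        - gaussianSmoothingDeriv h √(T ω) (S ω) * X ω
        - (gaussianSmoothingDeriv2 h √(T ω) (S ω) / 2 * X ω ^ 2
          - gaussianSmoothingDeriv2 h √(T ω) (S ω) / 2 * U ω)) (by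
    filter_upwards [hTa, hU0, hJ] with ω h1 h2 h3
    have hT0 : 0 < T ω := ha.trans_le h1
    rw [← mul_sub]
    refine (gaussianSmoothing_replacement_le hh hT0 h2 (S ω) (X ω)).trans ?_
    calc _ ≤ (|X ω| ^ 3 + 2 * M ω) / (3 * T ω) := by gcongr
      _ = _ := by simp only [Pi.add_apply]; field_simp)
  simp only [Pi.add_apply] at key
  rw [integral_add (i3.div_const 3) (i3'.const_mul (2 / 3)), integral_div, integral_const_mul,
    e3] at key
  refine (key.trans (le_of_eq (b := ∫ ω, (T ω)⁻¹ * M ω ∂μ) (by ring))).trans ?_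
  rw [← integral_const_mul]
  refine integral_mono_ae i3' (logi.const_mul _) ?_
  filter_upwards [hTa, hU0, hJ, hβδ] with ω h1 h2 h3 h4
  have hT0 : 0 < T ω := ha.trans_le h1
  have h5 := (le_min_iff.1 h4).1
  have h6 := (le_min_iff.1 h4).2
  have hUb : U ω ≤ β ^ (2 / 3 : ℝ) := by
    calc U ω = (√(U ω) ^ 3) ^ (2 / 3 : ℝ) := by
          rw [sqrt_eq_rpow, ← rpow_natCast, ← rpow_mul h2, ← rpow_mul h2]
          norm_num
      _ ≤ _ := by
          refine rpow_le_rpow (by positivity) (h3.trans h5) (by norm_num)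
  calc (T ω)⁻¹ * M ω ≤ (T ω)⁻¹ * (δ * U ω) := by gcongr
    _ = δ * (U ω / T ω) := by ring
    _ ≤ δ * ((1 + β ^ (2 / 3 : ℝ) / a) * (log (T ω + U ω) - log (T ω))) := by
      gcongr
      exact div_le_mul_log_sub_log ha h1 h2 hUb
    _ = _ := by ring

/-- **Corollary 2** (Röllin): if `V_n² = s_n²` a.s. and the conditional third moments satisfy
`E(|X_k|³|F_{k-1}) ≤ min(β, δσ_k²)` a.s., then
`d_W(L(S_n/s_n), N(0,1)) ≤ 3δn(s_n²/n + β^{2/3})(1 + log n)/s_n³ + 2/√n`. -/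
theorem mean_martingale_clt_wasserstein_cond_third_moment
    {Ω : Type*} [m : MeasurableSpace Ω] {μ : Measure Ω} [IsProbabilityMeasure μ]
    (n : ℕ) (hn : 1 ≤ n)
    (ℱ : Filtration ℕ m)
    (X : ℕ → Ω → ℝ)
    -- martingale difference sequence:
    (hadp : ∀ k, 1 ≤ k → k ≤ n → StronglyMeasurable[ℱ k] (X k))
    (hint : ∀ k, 1 ≤ k → k ≤ n → Integrable (X k) μ)
    (hmds : ∀ k, 1 ≤ k → k ≤ n → μ[X k | ℱ (k - 1)] =ᵐ[μ] 0)
    -- finite third moments: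
    (hX3 : ∀ k, 1 ≤ k → k ≤ n → Integrable (fun ω => |X k ω| ^ 3) μ)
    -- conditional variances σ_k² = E(X_k²|F_{k-1}):
    (σ2 : ℕ → Ω → ℝ)
    (hσ2 : ∀ k, σ2 k = μ[fun ω => (X k ω) ^ 2 | ℱ (k - 1)])
    -- s_n² = Var S_n = ∑ E X_i²:
    (sn : ℝ) (hsn : 0 < sn)
    (hsn2 : sn ^ 2 = ∑ i ∈ Icc 1 n, ∫ ω, (X i ω) ^ 2 ∂μ)
    -- assumption V_n² = s_n² a.s.:
    (hV : ∀ᵐ ω ∂μ, (∑ i ∈ Icc 1 n, σ2 i ω) = sn ^ 2)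
    -- conditional third moment bound E(|X_k|³|F_{k-1}) ≤ β ∧ δσ_k²:
    (β δ : ℝ)
    (hβδ : ∀ k, 1 ≤ k → k ≤ n →
      μ[fun ω => |X k ω| ^ 3 | ℱ (k - 1)] ≤ᵐ[μ] fun ω => min β (δ * σ2 k ω))
    (h : ℝ → ℝ) (hh : LipschitzWith 1 h) :
    |(∫ ω, h ((∑ i ∈ Icc 1 n, X i ω) / sn) ∂μ) - ∫ x, h x ∂(gaussianReal 0 1)|
      ≤ 3 * δ * n * (sn ^ 2 / n + β ^ ((2 : ℝ) / 3)) * (1 + Real.log n) / sn ^ 3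
        + 2 / Real.sqrt n := by
  have hn0 : (0 : ℝ) < n := by exact_mod_cast hn
  set a : ℝ := sn ^ 2 / n with ha_def
  have ha : 0 < a := by positivity
  have hsub : ∀ k, 1 ≤ k → k ≤ n → Integrable (fun ω => X k ω ^ 2) μ := fun k h1 h2 =>
    integrable_sq_of_integrable_abs_cube (hint k h1 h2) (hX3 k h1 h2)
  have hσ0 : ∀ᵐ ω ∂μ, ∀ k, 0 ≤ σ2 k ω := by
    rw [ae_all_iff]
    intro k
    rw [hσ2]
    exact condExp_nonneg (Filter.Eventually.of_forall fun ω => sq_nonneg _)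
  have hmin : ∀ᵐ ω ∂μ, ∀ k, 1 ≤ k → k ≤ n → 0 ≤ β ∧ 0 ≤ δ * σ2 k ω := by
    rw [ae_all_iff]
    intro k
    by_cases hk : 1 ≤ k ∧ k ≤ n
    · have h0 : 0 ≤ᵐ[μ] μ[fun ω => |X k ω| ^ 3 | ℱ (k - 1)] :=
        condExp_nonneg (Filter.Eventually.of_forall fun ω => by positivity)
      filter_upwards [h0, hβδ k hk.1 hk.2] with ω h1 h2 _ _
      exact le_min_iff.1 (le_trans h1 h2)
    · exact Filter.Eventually.of_forall fun ω h1 h2 => absurd ⟨h1, h2⟩ hk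
  obtain ⟨hβ, hδ⟩ : 0 ≤ β ∧ 0 ≤ δ := by
    obtain ⟨ω, h1, h2, h3⟩ := (hσ0.and (hmin.and hV)).exists
    refine ⟨(h2 1 le_rfl hn).1, ?_⟩
    by_contra! hneg
    have : ∑ i ∈ Icc 1 n, σ2 i ω ≤ 0 := sum_nonpos fun i hi => by
      rw [Finset.mem_Icc] at hi
      have := (h2 i hi.1 hi.2).2
      nlinarith [h1 i]
    rw [h3] at this
    nlinarith
  set H : ℝ → ℝ := fun u => sn * h (u / sn) with hH_def
  have hH : LipschitzWith 1 H := by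
    refine LipschitzWith.of_dist_le_mul fun x y => ?_
    have := hh.abs_sub_le_of_one (x / sn) (y / sn)
    rw [← sub_div, abs_div, abs_of_pos hsn, one_mul, le_div_iff₀ hsn] at this
    simp only [hH_def, Real.dist_eq, NNReal.coe_one, one_mul]
    rw [← mul_sub, abs_mul, abs_of_pos hsn]
    linarith
  set S : ℕ → Ω → ℝ := fun k ω => ∑ i ∈ Icc 1 k, X i ω with hS_def
  set T : ℕ → Ω → ℝ := fun k ω => sn ^ 2 + a - ∑ i ∈ Icc 1 k, σ2 i ω with hT_def
  have hS_succ : ∀ k ω, S (k + 1) ω = S k ω + X (k + 1) ω := fun k ω =>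
    sum_Icc_succ_top (by omega) _
  have hT_succ : ∀ k ω, T (k + 1) ω + σ2 (k + 1) ω = T k ω := fun k ω => by
    simp only [hT_def]
    rw [sum_Icc_succ_top (by omega)]
    ring
  have hSi : ∀ k, k ≤ n → Integrable (S k) μ := fun k hk =>
    integrable_finsetSum _ fun i hi => by
      rw [Finset.mem_Icc] at hi
      exact hint i hi.1 (hi.2.trans hk)
  have hSm : ∀ k, k ≤ n → StronglyMeasurable[ℱ k] (S k) := fun k hk =>
    Finset.stronglyMeasurable_fun_sum _ fun i hi => by
      rw [Finset.mem_Icc] at hi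
      exact (hadp i hi.1 (hi.2.trans hk)).mono (ℱ.mono hi.2)
  have hTm : ∀ k, StronglyMeasurable[ℱ (k - 1)] (T k) := fun k =>
    stronglyMeasurable_const.sub <| Finset.stronglyMeasurable_fun_sum _ fun i hi => by
      rw [Finset.mem_Icc] at hi
      rw [hσ2]
      exact stronglyMeasurable_condExp.mono (ℱ.mono (by omega))
  have hTb : ∀ᵐ ω ∂μ, ∀ k, k ≤ n → a ≤ T k ω ∧ T k ω ≤ sn ^ 2 + a := by
    filter_upwards [hσ0, hV] with ω h1 h2 k hk
    have h3 : ∑ i ∈ Icc 1 k, σ2 i ω ≤ ∑ i ∈ Icc 1 n, σ2 i ω :=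
      sum_le_sum_of_subset_of_nonneg (Icc_subset_Icc_right hk) fun i _ _ => h1 i
    have h4 : 0 ≤ ∑ i ∈ Icc 1 k, σ2 i ω := sum_nonneg fun i _ => h1 i
    simp only [hT_def]
    constructor <;> linarith
  have hlog : ∀ k, k ≤ n → Integrable (fun ω => log (T k ω)) μ := fun k hk => by
    refine (integrable_const (|log a| + |log (sn ^ 2 + a)|)).mono'
      ((measurable_log.comp (hTm k).measurable).mono (ℱ.le _) le_rfl).aestronglyMeasurable ?_
    filter_upwards [hTb] with ω h1
    have h2 := log_le_log ha (h1 k hk).1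
    have h3 := log_le_log (ha.trans_le (h1 k hk).1) (h1 k hk).2
    rw [Real.norm_eq_abs, abs_le]
    constructor
    · linarith [neg_abs_le (log a), abs_nonneg (log (sn ^ 2 + a))]
    · linarith [le_abs_self (log (sn ^ 2 + a)), abs_nonneg (log a)]
  set D : ℝ := δ * (1 + β ^ (2 / 3 : ℝ) / a) with hD
  have hD0 : 0 ≤ D := by positivity
  set Ψ : ℕ → ℝ := fun k => ∫ ω, gaussianSmoothing H √(T k ω) (S k ω) ∂μ with hΨ
  have htel : ∀ k, k ≤ n →
      |Ψ k - Ψ 0| ≤ D * (∫ ω, log (T 0 ω) ∂μ - ∫ ω, log (T k ω) ∂μ) := by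
    intro k
    induction k with
    | zero => intro _; simp
    | succ k ih =>
      intro hk
      have step := gaussianSmoothing_martingale_step (ℱ.le k) hH (S := S k) (T := T (k + 1))
        (hint (k + 1) (by omega) hk) (hmds (k + 1) (by omega) hk) (hX3 (k + 1) (by omega) hk)
        (hSm k (by omega)) (hSi k (by omega)) (hTm (k + 1)) (hσ2 (k + 1)) ha
        (c := sn ^ 2 + a) (hTb.mono fun ω h1 => (h1 (k + 1) hk).1)
        (hTb.mono fun ω h1 => by rw [hT_succ]; exact (h1 k (by omega)).2)
        (hβδ (k + 1) (by omega) hk) hδ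
      simp only [hT_succ, ← hS_succ] at step
      rw [integral_sub (hlog k (by omega)) (hlog (k + 1) hk)] at step
      have := abs_sub_le (Ψ (k + 1)) (Ψ k) (Ψ 0)
      have := ih (by omega)
      simp only [hΨ] at *
      linarith
  have hmain := htel n le_rfl
  have hT0 : ∀ ω, T 0 ω = sn ^ 2 + a := fun ω => by simp [hT_def]
  have hTn : ∀ᵐ ω ∂μ, T n ω = a := by
    filter_upwards [hV] with ω h1
    simp [hT_def, h1]
  have hΨ0 : Ψ 0 = gaussianSmoothing H √(sn ^ 2 + a) 0 := by
    simp [hΨ, hT0, hS_def]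
  have hΨn : Ψ n = ∫ ω, gaussianSmoothing H √a (S n ω) ∂μ :=
    integral_congr_ae (hTn.mono fun ω h1 => by simp only [h1])
  have hlogn : ∫ ω, log (T n ω) ∂μ = log a := by
    rw [integral_congr_ae (g := fun _ => log a) (hTn.mono fun ω h1 => by simp only [h1])]
    simp
  simp only [hT0, hlogn, integral_const, probReal_univ, one_smul] at hmain
  have hlog_le : log (sn ^ 2 + a) - log a ≤ 1 + log n := by
    rw [← log_div (by positivity) ha.ne']
    have e : (sn ^ 2 + a) / a = n + 1 := by
      rw [ha_def]; field_simp
    rw [e]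
    have h1 : (n : ℝ) + 1 ≤ exp 1 * n := by
      have := add_one_le_exp (1 : ℝ)
      have : (1 : ℝ) ≤ n := by exact_mod_cast hn
      nlinarith
    calc log (n + 1) ≤ log (exp 1 * n) := log_le_log (by positivity) h1
      _ = 1 + log n := by rw [log_mul (exp_ne_zero 1) hn0.ne', log_exp]
  have hend0 : |Ψ 0 - sn * ∫ x, h x ∂(gaussianReal 0 1)| ≤ √a := by
    have e : sn * ∫ x, h x ∂(gaussianReal 0 1) = gaussianSmoothing H sn 0 := by
      simp only [gaussianSmoothing, hH_def, zero_add]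
      rw [integral_const_mul]
      simp only [mul_div_cancel_left₀ _ hsn.ne']
    rw [e, hΨ0]
    refine (abs_gaussianSmoothing_sub_le hH _ _ _).trans (abs_le.2 ⟨?_, ?_⟩)
    · have : sn ≤ √(sn ^ 2 + a) := le_sqrt_of_sq_le (by linarith)
      linarith [sqrt_nonneg a]
    · have : √(sn ^ 2 + a) ≤ sn + √a := by
        rw [sqrt_le_left (by positivity)]
        nlinarith [sq_sqrt ha.le, mul_nonneg hsn.le (sqrt_nonneg a)]
      linarith
  have hSn := hSi n le_rfl
  have hendn : |sn * (∫ ω, h ((∑ i ∈ Icc 1 n, X i ω) / sn) ∂μ) - Ψ n| ≤ √a := by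
    have i1 : Integrable (fun ω => H (S n ω)) μ := by
      refine ((integrable_const |H 0|).add hSn.abs).mono'
        (hH.continuous.comp_aestronglyMeasurable hSn.aestronglyMeasurable)
        (Filter.Eventually.of_forall fun ω => ?_)
      have := abs_gaussianSmoothing_le hH 0 (S n ω)
      rw [gaussianSmoothing_zero, abs_zero, add_zero] at this
      exact this
    have i2 : Integrable (fun ω => gaussianSmoothing H √a (S n ω)) μ := by
      refine ((integrable_const (|H 0| + √a)).add hSn.abs).mono'
        ((stronglyMeasurable_gaussianSmoothing_uncurry hH.continuous).1.measurable.comp_aemeasurable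
          (f := fun ω => (√a, S n ω))
          (aemeasurable_const.prodMk hSn.aemeasurable)).aestronglyMeasurable
        (Filter.Eventually.of_forall fun ω => ?_)
      have := abs_gaussianSmoothing_le hH √a (S n ω)
      rw [abs_of_nonneg (sqrt_nonneg a)] at this
      simp only [Real.norm_eq_abs, Pi.add_apply]
      linarith
    rw [← integral_const_mul, hΨn, ← integral_sub i1 i2]
    have := norm_integral_le_of_norm_le (integrable_const (μ := μ) √a)
      (f := fun ω => H (S n ω) - gaussianSmoothing H √a (S n ω))
      (Filter.Eventually.of_forall fun ω => by
        have := abs_gaussianSmoothing_sub_le hH 0 √a (S n ω)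
        rw [gaussianSmoothing_zero, zero_sub, abs_neg, abs_of_nonneg (sqrt_nonneg a)] at this
        exact this)
    simpa using this
  set A := ∫ ω, h ((∑ i ∈ Icc 1 n, X i ω) / sn) ∂μ
  set B := ∫ x, h x ∂(gaussianReal 0 1)
  have hlogn0 : 0 ≤ 1 + log (n : ℝ) := by
    have := log_nonneg (x := (n : ℝ)) (by exact_mod_cast hn)
    linarith
  have htotal : sn * |A - B| ≤ D * (1 + log n) + 2 * √a := by
    have h1 : sn * |A - B| = |sn * A - sn * B| := by
      rw [← mul_sub, abs_mul, abs_of_pos hsn]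
    have h2 := abs_sub_le (sn * A) (Ψ n) (sn * B)
    have h3 := abs_sub_le (Ψ n) (Ψ 0) (sn * B)
    have h4 := mul_le_mul_of_nonneg_left hlog_le hD0
    linarith
  have hsqrt : √a = sn / √n := by
    rw [ha_def, sqrt_div (sq_nonneg _), sqrt_sq hsn.le]
  have hDeq : D * (1 + log n) / sn =
      δ * n * (sn ^ 2 / n + β ^ (2 / 3 : ℝ)) * (1 + log n) / sn ^ 3 := by
    rw [hD, ha_def]; field_simp
  have hDn : 0 ≤ D * (1 + log n) / sn := by positivity
  calc |A - B| ≤ (D * (1 + log n) + 2 * √a) / sn := by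
        rw [le_div_iff₀ hsn]; linarith
    _ = D * (1 + log n) / sn + 2 / √n := by rw [hsqrt]; field_simp
    _ ≤ 3 * (D * (1 + log n) / sn) + 2 / √n := by linarith
    _ = _ := by rw [hDeq]; ring
end
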